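/- arXiv:1408.5415 — 2 statements merged into one kernel-verified Lean document; each statement's English description precedes it below -/
import Mathlib

section
/- For all n ≥ 1, k ≥ 1 and all μ ∈ wcomp_{n−1} with supp(μ) ⊆ [k], the Möbius function of the maximal interval [0̂, [n]^μ] of Π_n^k satisfies μ̄_{Π_n^k}(0̂, [n]^μ) = (−1)^{n−1} |Q^{AA}_μ| = (−1)^{n−1} |Q^{TN}_μ|, where Q^{AA}_μ and Q^{TN}_μ are the sets of AA-colored and TN-colored μ-colored Stirling permutations on [n−1]. -/
/-! Weighted partition poset Π_n^k (raw representation).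
Elements of [n] are represented by `Fin n` (the element j+1 ↔ index j) and
colors 1,…,k are represented by `Fin k` (color i+1 ↔ index i). -/

abbrev WP (n k : ℕ) := Finset (Finset (Fin n) × (Fin k → ℕ))

namespace WP

variable {n k : ℕ}

/-- total weight `|μ|` of a weight vector supported in `[k]`. -/
def wsum (w : Fin k → ℕ) : ℕ := ∑ i, w i

/-- the raw finset is a genuine weighted partition of `[n]`. -/
def IsWP (π : WP n k) : Prop :=
  (∀ p ∈ π, p.1.Nonempty) ∧
  (∀ p ∈ π, ∀ q ∈ π, p ≠ q → Disjoint p.1 q.1) ∧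
  (∀ x : Fin n, ∃ p ∈ π, x ∈ p.1) ∧
  (∀ p ∈ π, wsum p.2 + 1 = p.1.card)

/-- the order relation of `Π_n^k`. -/
def le (π ρ : WP n k) : Prop :=
  IsWP π ∧ IsWP ρ ∧
  (∀ p ∈ π, ∃ q ∈ ρ, p.1 ⊆ q.1) ∧
  (∀ q ∈ ρ,
    (∀ i, (∑ p ∈ π.filter (fun p => p.1 ⊆ q.1), p.2 i) ≤ q.2 i) ∧
    (∑ i, (q.2 i - ∑ p ∈ π.filter (fun p => p.1 ⊆ q.1), p.2 i))
      = (π.filter (fun p => p.1 ⊆ q.1)).card - 1)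

def lt (π ρ : WP n k) : Prop := le π ρ ∧ π ≠ ρ

/-- the minimum element `0̂` of `Π_n^k`. -/
def bot (n k : ℕ) : WP n k := Finset.univ.image (fun x => ({x}, fun _ => 0))

/-- the maximal element `[n]^μ` of `Π_n^k`. -/
def top (n k : ℕ) (f : Fin k → ℕ) : WP n k := {(Finset.univ, f)}

-- `mobiusAux r m` iterates the defining recursion of the Möbius function of the
-- relation `r`, `m` times.  For `m` at least the length of the interval `[a,b]` this
-- computes the Möbius function `μ̄(a,b)` of the poset.
open Classical in
noncomputable def mobiusAux {Q : Type*} (r : Q → Q → Prop) : ℕ → Q → Q → ℤ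
  | 0, a, b => if a = b then 1 else 0
  | m+1, a, b => if a = b then 1 else - ∑ᶠ c ∈ {c | r a c ∧ r c b ∧ c ≠ b}, mobiusAux r m a c

/-- the Möbius function `μ̄_{Π_n^k}` (intervals of `Π_n^k` have length at most `n`). -/
noncomputable def mobius (a b : WP n k) : ℤ := mobiusAux le n a b

end WP

/-! Stirling permutations, as lists of natural numbers. -/

/-- `w` is a Stirling permutation on the finite set `A` of positive integers:
every letter of `A` occurs exactly twice, no other letter occurs, and every
letter lying strictly between the two occurrences of a letter `a` is larger
than `a`. -/
def IsStirling (A : Finset ℕ) (w : List ℕ) : Prop :=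
  (∀ a, w.count a = if a ∈ A then 2 else 0) ∧
  (∀ a b : ℕ, ∀ i l j : ℕ, i < l → l < j → w[i]? = some a → w[j]? = some a →
      w[l]? = some b → a < b)

/-- the set `Q_A` of Stirling permutations on `A` -/
def QSetA (A : Finset ℕ) : Set (List ℕ) := {w | IsStirling A w}

/-- the set `Q_m` of Stirling permutations on `[m]` -/
def QSet (m : ℕ) : Set (List ℕ) := QSetA (Finset.Icc 1 m)

/-- `(a,b)` is an ascending adjacent pair of `w`: `a < b` and the second
occurrence of `a` immediately precedes the first occurrence of `b`. -/
def AApair (w : List ℕ) (a b : ℕ) : Prop :=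
  a < b ∧ ∃ i, w[i]? = some a ∧ w[i+1]? = some b ∧
    (w.take (i+1)).count a = 2 ∧ (w.take (i+1)).count b = 0

/-- `(a,b)` is a terminally nested pair of `w`: `a < b` and the second
occurrence of `a` immediately follows the second occurrence of `b`. -/
def TNpair (w : List ℕ) (a b : ℕ) : Prop :=
  a < b ∧ ∃ i, w[i]? = some b ∧ w[i+1]? = some a ∧
    (w.take (i+1)).count b = 2 ∧ (w.take (i+2)).count a = 2

-- Given a relation `R` on letters which is a partial matching (as `AApair w`
-- and `TNpair w` are), the multiset of sizes of the blocks of the partition of `A`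
-- generated by `R`, i.e. the multiset of lengths of the maximal `R`-chains.
-- This gives the types `λ^{AA}` and `λ^{TN}` of a Stirling permutation.
open Classical in
noncomputable def chainType (A : Finset ℕ) (R : ℕ → ℕ → Prop) : Multiset ℕ :=
  ((A.image fun a => A.filter fun b => Relation.EqvGen R a b).val.map Finset.card)

/-- splits off the first block `a τ a` of a Stirling permutation. -/
def blockSplit (w : List ℕ) : List ℕ × List ℕ :=
  match w with
  | [] => ([], [])
  | a :: rest =>
    let i := rest.findIdx (· = a)
    (a :: rest.take (i+1), rest.drop (i+1))

/-- block factorization of a Stirling permutation (with fuel). -/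
def toBlocksAux : ℕ → List ℕ → List (List ℕ)
  | 0, _ => []
  | _+1, [] => []
  | f+1, w => (blockSplit w).1 :: toBlocksAux f (blockSplit w).2

def toBlocks (w : List ℕ) : List (List ℕ) := toBlocksAux w.length w

/-- splits a list of blocks at the first descent of the leading letters:
this gives the ascending adjacent factorization `θ = θ¹θ²`. -/
def splitAtDescent : List (List ℕ) → Option (List (List ℕ) × List (List ℕ))
  | [] => none
  | [_] => none
  | b :: b' :: rest =>
    if b'.headD 0 < b.headD 0 then some ([b], b' :: rest)
    else (splitAtDescent (b' :: rest)).map fun p => (b :: p.1, p.2)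

/-- the bijection `ξ : Q_A → Q_A` (with fuel).  On an irreducible AA-word
`a₁τ₁a₁ a₂τ₂a₂ ⋯ a_kτ_ka_k` it returns
`a₁ξ(τ₁) a₂ξ(τ₂) ⋯ a_{k-1}ξ(τ_{k-1}) a_k a_k a_{k-1} ⋯ a₂ a₁ ξ(τ_k)`, and it is
multiplicative on the complete ascending adjacent factorization. -/
def xiAux : ℕ → List ℕ → List ℕ
  | 0, w => w
  | f+1, w =>
    let bs := toBlocks w
    match splitAtDescent bs with
    | some p => xiAux f p.1.flatten ++ xiAux f p.2.flatten
    | none =>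
      match bs with
      | [] => []
      | _ =>
        let heads := bs.map fun b => b.headD 0
        let inners := bs.map fun b => (b.drop 1).dropLast
        (List.zipWith (fun a τ => a :: xiAux f τ) heads.dropLast inners.dropLast).flatten
          ++ (heads.getLastD 0 :: heads.reverse) ++ xiAux f (inners.getLastD [])

def xiMap (w : List ℕ) : List ℕ := xiAux (w.length + 1) w

/-- the subword of first occurrences of the letters of `w` (with fuel). -/
def initAux : ℕ → List ℕ → List ℕ
  | 0, _ => []
  | _+1, [] => []
  | f+1, a :: rest => a :: initAux f (rest.filter (· ≠ a))

/-- the initial permutation `init(θ)` -/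
def initPerm (w : List ℕ) : List ℕ := initAux w.length w

/-- the set `Q^{AA}_μ` of AA-colored `μ`-colored Stirling permutations on `[n-1]`,
for `μ ∈ wcomp_{n-1}` with `supp(μ) ⊆ [k]` given by `f : Fin k → ℕ`.  A coloring
is a function `c : ℕ → ℕ` taking values in `{0,…,k-1}` (color index `i`
represents the paper's color `i+1`) on the letters `1,…,n-1` and `0` elsewhere. -/
def QAAset (n k : ℕ) (f : Fin k → ℕ) : Set (List ℕ × (ℕ → ℕ)) :=
  {p | IsStirling (Finset.Icc 1 (n - 1)) p.1 ∧
    (∀ a b, AApair p.1 a b → p.2 b < p.2 a) ∧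
    (∀ a ∈ Finset.Icc 1 (n - 1), p.2 a < k) ∧
    (∀ a, a ∉ Finset.Icc 1 (n - 1) → p.2 a = 0) ∧
    (∀ i : Fin k, ((Finset.Icc 1 (n - 1)).filter fun a => p.2 a = (i : ℕ)).card = f i)}

/-- the set `Q^{TN}_μ` of TN-colored `μ`-colored Stirling permutations on `[n-1]` -/
def QTNset (n k : ℕ) (f : Fin k → ℕ) : Set (List ℕ × (ℕ → ℕ)) :=
  {p | IsStirling (Finset.Icc 1 (n - 1)) p.1 ∧
    (∀ a b, TNpair p.1 a b → p.2 b < p.2 a) ∧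
    (∀ a ∈ Finset.Icc 1 (n - 1), p.2 a < k) ∧
    (∀ a, a ∉ Finset.Icc 1 (n - 1) → p.2 a = 0) ∧
    (∀ i : Fin k, ((Finset.Icc 1 (n - 1)).filter fun a => p.2 a = (i : ℕ)).card = f i)}

namespace SP

/-- increasing ternary trees with colored nodes -/
inductive T (k : ℕ) where
  | nil : T k
  | node (a : ℕ) (c : Fin k) (l m r : T k) : T k

namespace T
variable {k : ℕ}

def labels : T k → Finset ℕ
  | nil => ∅
  | node a _ l m r => insert a (labels l ∪ labels m ∪ labels r)

def WF : T k → Prop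
  | nil => True
  | node a _ l m r => (∀ x ∈ labels l, a < x) ∧ (∀ x ∈ labels m, a < x) ∧ (∀ x ∈ labels r, a < x) ∧
      Disjoint (labels l) (labels m) ∧ Disjoint (labels l) (labels r) ∧
      Disjoint (labels m) (labels r) ∧ WF l ∧ WF m ∧ WF r

def word : T k → List ℕ
  | nil => []
  | node a _ l m r => word l ++ a :: (word m ++ a :: word r)

def col : T k → ℕ → ℕ
  | nil, _ => 0
  | node a c l m r, x => if x = a then c else if x ∈ labels l then col l x
      else if x ∈ labels m then col m x else col r x

noncomputable def cont : T k → (Fin k →₀ ℕ)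
  | nil => 0
  | node _ c l m r => Finsupp.single c 1 + cont l + cont m + cont r

def fst : T k → Option (ℕ × Fin k)
  | nil => none
  | node a c l _ _ => (fst l).or (some (a, c))

def lst : T k → Option (ℕ × Fin k)
  | nil => none
  | node a c _ _ r => (lst r).or (some (a, c))

def AAok : T k → Prop
  | nil => True
  | node _ c l m r => (∀ p ∈ fst r, p.2 < c) ∧ AAok l ∧ AAok m ∧ AAok r

def TNok : T k → Prop
  | nil => True
  | node _ c l m r => (∀ p ∈ lst m, p.2 < c) ∧ TNok l ∧ TNok m ∧ TNok r

/-- rotation -/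
def rot : T k → T k
  | nil => nil
  | node a c l m r => node a c (rot m) (rot r) (rot l)

def rotInv : T k → T k
  | nil => nil
  | node a c l m r => node a c (rotInv r) (rotInv l) (rotInv m)

theorem rotInv_rot (t : T k) : rotInv (rot t) = t := by
  induction t <;> simp_all [rot, rotInv]

theorem rot_rotInv (t : T k) : rot (rotInv t) = t := by
  induction t <;> simp_all [rot, rotInv]

theorem labels_rot (t : T k) : labels (rot t) = labels t := by
  induction t with
  | nil => rfl
  | node a c l m r h1 h2 h3 =>
    simp only [rot, labels, h1, h2, h3]; ext x; simp; tauto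

theorem WF_rot (t : T k) : WF (rot t) ↔ WF t := by
  induction t with
  | nil => simp [rot]
  | node a c l m r h1 h2 h3 =>
    simp only [rot, WF, labels_rot, h1, h2, h3, disjoint_comm (a := labels r)]
    rw [disjoint_comm (a := labels m) (b := labels l)]; tauto

theorem cont_rot (t : T k) : cont (rot t) = cont t := by
  induction t with
  | nil => simp [rot]
  | node a c l m r h1 h2 h3 =>
    simp only [rot, cont, h1, h2, h3]; abel

theorem lst_rot (t : T k) : lst (rot t) = fst t := by
  induction t with
  | nil => simp [rot, lst, fst]
  | node a c l m r h1 h2 h3 =>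
    simp only [rot, lst, fst, h1]

theorem TNok_rot (t : T k) : TNok (rot t) ↔ AAok t := by
  induction t with
  | nil => simp [rot, TNok, AAok]
  | node a c l m r h1 h2 h3 =>
    simp only [rot, TNok, AAok, lst_rot, h1, h2, h3]; tauto

theorem mem_word (t : T k) (x : ℕ) : x ∈ word t ↔ x ∈ labels t := by
  induction t with
  | nil => simp [word, labels]
  | node a c l m r h1 h2 h3 => simp only [word, labels, List.mem_append, List.mem_cons, h1, h2, h3,
      Finset.mem_insert, Finset.mem_union]; tauto

theorem col_notMem (t : T k) (x : ℕ) (h : x ∉ labels t) : col t x = 0 := by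
  induction t with
  | nil => simp [col]
  | node a c l m r h1 h2 h3 => simp [labels] at h; simp [col, h, h3]

theorem col_lt (t : T k) (x : ℕ) (h : x ∈ labels t) : col t x < k := by
  induction t with
  | nil => simp [labels] at h
  | node a c l m r h1 h2 h3 =>
    simp [labels] at h; simp only [col]; split_ifs <;> simp_all

theorem col_l {a c} {l m r : T k} (h : WF (node a c l m r)) {x : ℕ} (hx : x ∈ labels l) :
    col (node a c l m r) x = col l x := by
  have := h.1 x hx
  simp [col, hx, this.ne']

theorem col_m {a c} {l m r : T k} (h : WF (node a c l m r)) {x : ℕ} (hx : x ∈ labels m) :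
    col (node a c l m r) x = col m x := by
  have h1 := h.2.1 x hx
  have h2 := Finset.disjoint_right.1 h.2.2.2.1 hx
  simp [col, hx, h1.ne', h2]

theorem col_r {a c} {l m r : T k} (h : WF (node a c l m r)) {x : ℕ} (hx : x ∈ labels r) :
    col (node a c l m r) x = col r x := by
  have h1 := h.2.2.1 x hx
  have h2 := Finset.disjoint_right.1 h.2.2.2.2.1 hx
  have h3 := Finset.disjoint_right.1 h.2.2.2.2.2.1 hx
  simp [col, h1.ne', h2, h3]

theorem col_a {a c} {l m r : T k} :
    col (node a c l m r) a = c := by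
  simp [col]

theorem card_col (t : T k) (h : WF t) (i : Fin k) :
    ((labels t).filter fun a => col t a = (i : ℕ)).card = cont t i := by
  induction t with
  | nil => simp [labels, cont]
  | node a c l m r h1 h2 h3 =>
    have hw := h
    obtain ⟨a1, a2, a3, d1, d2, d3, w1, w2, w3⟩ := h
    have na : a ∉ labels l ∪ labels m ∪ labels r := by
      simp only [Finset.mem_union]; rintro ((h|h)|h)
      · exact (a1 a h).false
      · exact (a2 a h).false
      · exact (a3 a h).false
    rw [Finset.card_filter, labels, Finset.sum_insert na, Finset.sum_union, Finset.sum_union d1,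
      Finset.sum_congr rfl (fun x hx => by rw [col_l hw hx]), ← Finset.card_filter, h1 w1,
      Finset.sum_congr rfl (fun x hx => by rw [col_m hw hx]), ← Finset.card_filter, h2 w2,
      Finset.sum_congr rfl (fun x hx => by rw [col_r hw hx]), ← Finset.card_filter, h3 w3]
    · simp [cont, col_a, Finsupp.single_apply, Fin.ext_iff]; ring
    · rw [Finset.disjoint_union_left]; exact ⟨d2, d3⟩

theorem head_word (t : T k) : (word t).head? = (fst t).map Prod.fst := by
  induction t with
  | nil => rfl
  | node a c l m r h1 h2 h3 =>
    rw [word, fst, List.head?_append, h1]; cases fst l <;> simp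

theorem last_word (t : T k) : (word t).getLast? = (lst t).map Prod.fst := by
  induction t with
  | nil => rfl
  | node a c l m r h1 h2 h3 =>
    rw [word, lst, show word l ++ a :: (word m ++ a :: word r) = (word l ++ a :: word m) ++ ([a] ++ word r) by simp, List.getLast?_append, List.getLast?_append, h3]; cases lst r <;> simp

theorem fst_mem (t : T k) (h : WF t) (p) (hp : p ∈ fst t) : p.1 ∈ labels t ∧ col t p.1 = p.2 := by
  induction t with
  | nil => simp [fst] at hp
  | node a c l m r h1 h2 h3 =>
    rw [fst] at hp
    cases hl : fst l with
    | none => simp [hl] at hp; subst hp; simp [labels, col_a]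
    | some q =>
      simp [hl] at hp; subst hp
      have := h1 h.2.2.2.2.2.2.1 (by simp [hl])
      rw [col_l h this.1]; simp [labels, this]

theorem lst_mem (t : T k) (h : WF t) (p) (hp : p ∈ lst t) : p.1 ∈ labels t ∧ col t p.1 = p.2 := by
  induction t with
  | nil => simp [lst] at hp
  | node a c l m r h1 h2 h3 =>
    rw [lst] at hp
    cases hl : lst r with
    | none => simp [hl] at hp; subst hp; simp [labels, col_a]
    | some q =>
      simp [hl] at hp; subst hp
      have := h3 h.2.2.2.2.2.2.2.2 (by simp [hl])
      rw [col_r h this.1]; simp [labels, this]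

theorem count_word (t : T k) (h : WF t) (x : ℕ) :
    (word t).count x = if x ∈ labels t then 2 else 0 := by
  induction t with
  | nil => simp [word, labels]
  | node a c l m r h1 h2 h3 =>
    obtain ⟨a1, a2, a3, d1, d2, d3, w1, w2, w3⟩ := h
    simp only [word, labels, List.count_append, List.count_cons, h1 w1, h2 w2, h3 w3]
    rw [Finset.disjoint_left] at d1 d2 d3
    specialize d1 (a := x); specialize d2 (a := x); specialize d3 (a := x)
    specialize a1 x; specialize a2 x; specialize a3 x
    simp only [Finset.mem_insert, Finset.mem_union, beq_iff_eq]
    grind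

end T

theorem append_cons_inj {a : ℕ} : ∀ {x x' y y' : List ℕ}, a ∉ x → a ∉ x' →
    x ++ a :: y = x' ++ a :: y' → x = x' ∧ y = y'
  | [], [], _, _, _, _, h => by simpa using h
  | [], b :: x', _, _, _, h2, h => by simp at h; simp [h.1] at h2
  | b :: x, [], _, _, h1, _, h => by simp at h; simp [h.1] at h1
  | b :: x, b' :: x', y, y', h1, h2, h => by
    simp at h h1 h2
    obtain ⟨rfl, h⟩ := h
    have := append_cons_inj h1.2 h2.2 h
    simpa using this

namespace T
variable {k : ℕ}

theorem labels_eq_of_word {t t' : T k} (h : word t = word t') : labels t = labels t' := by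
  ext x; rw [← mem_word, ← mem_word, h]

theorem inj (t t' : T k) (h : WF t) (h' : WF t') (hw : word t = word t')
    (hc : ∀ x, col t x = col t' x) : t = t' := by
  induction t generalizing t' with
  | nil => cases t' with
    | nil => rfl
    | node a c l m r => simp [word] at hw
  | node a c l m r h1 h2 h3 =>
    cases t' with
    | nil => simp [word] at hw
    | node a' c' l' m' r' =>
      have hl := labels_eq_of_word hw
      obtain ⟨a1, a2, a3, d1, d2, d3, w1, w2, w3⟩ := id h
      obtain ⟨a1', a2', a3', d1', d2', d3', w1', w2', w3'⟩ := id h'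
      have haa : a = a' := by
        have e1 : a ∈ labels (node a' c' l' m' r') := hl ▸ (by simp [labels])
        have e2 : a' ∈ labels (node a c l m r) := hl ▸ (by simp [labels])
        simp [labels] at e1 e2
        grind
      subst haa
      have hcc : c = c' := by
        have := hc a; rw [col_a, col_a] at this; exact Fin.ext this
      subst hcc
      simp only [word] at hw
      have nl : a ∉ word l := by rw [mem_word]; intro h; exact (a1 _ h).false
      have nl' : a ∉ word l' := by rw [mem_word]; intro h; exact (a1' _ h).false
      have nm : a ∉ word m := by rw [mem_word]; intro h; exact (a2 _ h).false
      have nm' : a ∉ word m' := by rw [mem_word]; intro h; exact (a2' _ h).false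
      obtain ⟨hw1, hw⟩ := append_cons_inj nl nl' hw
      obtain ⟨hw2, hw3⟩ := append_cons_inj nm nm' hw
      have l1 := labels_eq_of_word hw1
      have l2 := labels_eq_of_word hw2
      have l3 := labels_eq_of_word hw3
      rw [h1 l' w1 w1' hw1, h2 m' w2 w2' hw2, h3 r' w3 w3' hw3]
      · intro x
        by_cases hx : x ∈ labels r
        · rw [← col_r h hx, hc x, col_r h' (l3 ▸ hx)]
        · rw [col_notMem _ _ hx, col_notMem _ _ (l3 ▸ hx)]
      · intro x
        by_cases hx : x ∈ labels m
        · rw [← col_m h hx, hc x, col_m h' (l2 ▸ hx)]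
        · rw [col_notMem _ _ hx, col_notMem _ _ (l2 ▸ hx)]
      · intro x
        by_cases hx : x ∈ labels l
        · rw [← col_l h hx, hc x, col_l h' (l1 ▸ hx)]
        · rw [col_notMem _ _ hx, col_notMem _ _ (l1 ▸ hx)]

end T
end SP

namespace SP

def Nest (w : List ℕ) : Prop :=
  ∀ (u : List ℕ) (a : ℕ) (v z : List ℕ), w = u ++ a :: (v ++ a :: z) → ∀ b ∈ v, a < b

theorem nest_iff (w : List ℕ) : (∀ a b : ℕ, ∀ i l j : ℕ, i < l → l < j → w[i]? = some a →
    w[j]? = some a → w[l]? = some b → a < b) ↔ Nest w := by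
  constructor
  · intro h u a v z hw b hb
    obtain ⟨l, hl, rfl⟩ := List.mem_iff_getElem.1 hb
    refine h a _ u.length (u.length + 1 + l) (u.length + 1 + v.length) (by omega) (by omega) ?_ ?_ ?_
    · rw [hw]; simp
    · rw [hw, List.getElem?_append_right (by omega)]
      simp [show u.length + 1 + v.length - u.length = v.length + 1 by omega]
    · rw [hw, List.getElem?_append_right (by omega)]
      simp [show u.length + 1 + l - u.length = l + 1 by omega, List.getElem?_append_left hl]
  · intro h a b i l j hil hlj hi hj hl
    obtain ⟨hi', hi⟩ := List.getElem?_eq_some_iff.1 hi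
    obtain ⟨hj', hj⟩ := List.getElem?_eq_some_iff.1 hj
    obtain ⟨hl', hl⟩ := List.getElem?_eq_some_iff.1 hl
    refine h (w.take i) a ((w.drop (i+1)).take (j - (i+1))) (w.drop (j+1)) ?_ b ?_
    · have e1 : w.drop i = a :: w.drop (i+1) := by rw [List.drop_eq_getElem_cons hi', hi]
      have e2 : w.drop j = a :: w.drop (j+1) := by rw [List.drop_eq_getElem_cons hj', hj]
      rw [← e2]
      have : w.drop j = (w.drop (i+1)).drop (j - (i+1)) := by rw [List.drop_drop]; congr 1; omega
      rw [this, List.take_append_drop, ← e1, List.take_append_drop]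
    · rw [List.mem_iff_getElem]
      refine ⟨l - (i+1), ?_, ?_⟩
      · simp; omega
      · simp only [List.getElem_take, List.getElem_drop]
        rw [← hl]; congr 1; omega

theorem nest_infix {w u v : List ℕ} (h : Nest (u ++ (w ++ v))) : Nest w := by
  intro u' a v' z' hw b hb
  exact h (u ++ u') a v' (z' ++ v) (by rw [hw]; simp) b hb

def AAp (w : List ℕ) (a b : ℕ) : Prop :=
  a < b ∧ ∃ u v, w = u ++ a :: b :: v ∧ u.count a = 1 ∧ u.count b = 0

def TNp (w : List ℕ) (a b : ℕ) : Prop :=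
  a < b ∧ ∃ u v, w = u ++ b :: a :: v ∧ u.count b = 1 ∧ u.count a = 1

theorem cons2 {w : List ℕ} {i a b : ℕ} (hi : w[i]? = some a) (hj : w[i+1]? = some b) :
    w = w.take i ++ a :: b :: w.drop (i+2) := by
  obtain ⟨hi', hi⟩ := List.getElem?_eq_some_iff.1 hi
  obtain ⟨hj', hj⟩ := List.getElem?_eq_some_iff.1 hj
  have e1 : w.drop i = a :: w.drop (i+1) := by rw [List.drop_eq_getElem_cons hi', hi]
  have e2 : w.drop (i+1) = b :: w.drop (i+2) := by rw [List.drop_eq_getElem_cons hj', hj]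
  rw [← e2, ← e1, List.take_append_drop]

theorem AApair_iff (w : List ℕ) (a b : ℕ) : AApair w a b ↔ AAp w a b := by
  constructor
  · rintro ⟨hab, i, hi, hj, ha, hb⟩
    refine ⟨hab, w.take i, w.drop (i+2), cons2 hi hj, ?_, ?_⟩
    · rw [List.take_add_one, hi] at ha; simpa using ha
    · rw [List.take_add_one, hi] at hb; simp at hb; simp [hb]
  · rintro ⟨hab, u, v, rfl, ha, hb⟩
    refine ⟨hab, u.length, by simp, by simp, ?_, ?_⟩
    · simp [List.take_append, List.take_of_length_le, ha]
    · simp [List.take_append, List.take_of_length_le, hb, hab.ne]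

theorem TNpair_iff (w : List ℕ) (a b : ℕ) : TNpair w a b ↔ TNp w a b := by
  constructor
  · rintro ⟨hab, i, hi, hj, ha, hb⟩
    refine ⟨hab, w.take i, w.drop (i+2), cons2 hi hj, ?_, ?_⟩
    · rw [List.take_add_one, hi] at ha; simpa using ha
    · rw [List.take_add_one, List.take_add_one, hi, hj] at hb; simpa [hab.ne'] using hb
  · rintro ⟨hab, u, v, rfl, ha, hb⟩
    refine ⟨hab, u.length, by simp, by simp, ?_, ?_⟩
    · simp [List.take_append, List.take_of_length_le, ha]
    · simp [List.take_append, List.take_of_length_le, hb, hab.ne']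

/-- splitting a factor of length two across a concatenation -/
theorem split2 {w1 w2 u v : List ℕ} {a b : ℕ} (h : w1 ++ w2 = u ++ a :: b :: v) :
    (∃ v', w1 = u ++ a :: b :: v' ∧ v = v' ++ w2) ∨
    (w1 = u ++ [a] ∧ w2 = b :: v) ∨
    (∃ u', w2 = u' ++ a :: b :: v ∧ u = w1 ++ u') := by
  rcases List.append_eq_append_iff.1 h with ⟨x, h1, h2⟩ | ⟨x, h1, h2⟩
  · exact Or.inr (Or.inr ⟨x, h2, h1⟩)
  · match x, h1, h2 with
    | [], h1, h2 => exact Or.inr (Or.inr ⟨[], by simpa using h2.symm, by simpa using h1.symm⟩)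
    | [c], h1, h2 =>
      simp at h2
      obtain ⟨rfl, h2⟩ := h2
      exact Or.inr (Or.inl ⟨h1, h2.symm⟩)
    | c :: d :: x, h1, h2 =>
      simp at h2
      obtain ⟨rfl, rfl, h2⟩ := h2
      exact Or.inl ⟨x, h1, h2⟩

theorem AAp_append {w1 w2 : List ℕ} (hd : w1.Disjoint w2) (a b : ℕ) :
    AAp (w1 ++ w2) a b ↔ AAp w1 a b ∨ AAp w2 a b ∨
      (a < b ∧ w1.count a = 2 ∧ w1.getLast? = some a ∧ w2.head? = some b) := by
  constructor
  · rintro ⟨hab, u, v, h, ha, hb⟩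
    rcases split2 h with ⟨v', h1, rfl⟩ | ⟨h1, h2⟩ | ⟨u', h1, h2⟩
    · exact Or.inl ⟨hab, u, v', h1, ha, hb⟩
    · refine Or.inr (Or.inr ⟨hab, ?_, ?_, ?_⟩) <;> simp [h1, h2, ha]
    · refine Or.inr (Or.inl ⟨hab, u', v, h1, ?_, ?_⟩)
      · have : w1.count a = 0 := List.count_eq_zero_of_not_mem (fun hh => hd hh (by simp [h1]))
        rw [h2] at ha; simpa [this] using ha
      · rw [h2] at hb; simp only [List.count_append] at hb; omega
  · rintro (⟨hab, u, v, h, ha, hb⟩ | ⟨hab, u, v, h, ha, hb⟩ | ⟨hab, h1, h2, h3⟩)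
    · exact ⟨hab, u, v ++ w2, by simp [h], ha, hb⟩
    · refine ⟨hab, w1 ++ u, v, by simp [h], ?_, ?_⟩
      · have : w1.count a = 0 := List.count_eq_zero_of_not_mem (fun hh => hd hh (by simp [h]))
        simp [ha, this]
      · have : w1.count b = 0 := List.count_eq_zero_of_not_mem (fun hh => hd hh (by simp [h]))
        simp only [List.count_append, hb, this]
    · obtain ⟨u, rfl⟩ := List.getLast?_eq_some_iff.1 h2
      obtain ⟨v, rfl⟩ := List.head?_eq_some_iff.1 h3
      refine ⟨hab, u, v, by simp, by simpa using h1, ?_⟩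
      exact List.count_eq_zero_of_not_mem (fun hh => hd (a := b) (by simp [hh]) (by simp))

theorem TNp_append {w1 w2 : List ℕ} (hd : w1.Disjoint w2) (a b : ℕ) :
    TNp (w1 ++ w2) a b ↔ TNp w1 a b ∨ TNp w2 a b := by
  constructor
  · rintro ⟨hab, u, v, h, ha, hb⟩
    rcases split2 h with ⟨v', h1, rfl⟩ | ⟨h1, h2⟩ | ⟨u', h1, h2⟩
    · exact Or.inl ⟨hab, u, v', h1, ha, hb⟩
    · exfalso
      have : a ∈ u := List.count_pos_iff.1 (by omega)
      exact hd (a := a) (by simp [h1, this]) (by simp [h2])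
    · refine Or.inr ⟨hab, u', v, h1, ?_, ?_⟩
      · have : w1.count b = 0 := List.count_eq_zero_of_not_mem (fun hh => hd hh (by simp [h1]))
        rw [h2] at ha; simpa [this] using ha
      · have : w1.count a = 0 := List.count_eq_zero_of_not_mem (fun hh => hd hh (by simp [h1]))
        rw [h2] at hb; simpa [this] using hb
  · rintro (⟨hab, u, v, h, ha, hb⟩ | ⟨hab, u, v, h, ha, hb⟩)
    · exact ⟨hab, u, v ++ w2, by simp [h], ha, hb⟩
    · refine ⟨hab, w1 ++ u, v, by simp [h], ?_, ?_⟩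
      · have : w1.count b = 0 := List.count_eq_zero_of_not_mem (fun hh => hd hh (by simp [h]))
        simp [ha, this]
      · have : w1.count a = 0 := List.count_eq_zero_of_not_mem (fun hh => hd hh (by simp [h]))
        simp [hb, this]


theorem AAp_block {s : ℕ} {w : List ℕ} (hs : ∀ x ∈ w, s < x) (a b : ℕ) :
    AAp (s :: (w ++ [s])) a b ↔ AAp w a b := by
  constructor
  · rintro ⟨hab, u, v, h, ha, hb⟩
    match u, h, ha, hb with
    | [], _, ha, _ => simp at ha
    | c :: u, h, ha, hb =>
      simp only [List.cons_append, List.cons.injEq] at h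
      obtain ⟨rfl, h⟩ := h
      have hbs : s ≠ b := by rintro rfl; simp at hb
      rcases split2 h with ⟨v', h1, h2⟩ | ⟨h1, h2⟩ | ⟨u', h1, h2⟩
      · have : s ≠ a := by rintro rfl; exact (hs s (by simp [h1])).false
        refine ⟨hab, u, v', h1, ?_, ?_⟩
        · simpa [List.count_cons, this] using ha
        · simpa [List.count_cons, hbs] using hb
      · simp at h2; exact absurd h2.1 hbs
      · have := congrArg List.length h1; simp at this
        omega
  · rintro ⟨hab, u, v, h, ha, hb⟩
    have h1 : s ≠ a := by rintro rfl; exact (hs s (by simp [h])).false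
    have h2 : s ≠ b := by rintro rfl; exact (hs s (by simp [h])).false
    refine ⟨hab, s :: u, v ++ [s], by simp [h], ?_, ?_⟩
    · simpa [List.count_cons, h1] using ha
    · simpa [List.count_cons, h2] using hb

theorem TNp_block {s : ℕ} {w : List ℕ} (hs : ∀ x ∈ w, s < x) (a b : ℕ) :
    TNp (s :: (w ++ [s])) a b ↔ TNp w a b ∨
      (a = s ∧ s < b ∧ w.count b = 2 ∧ w.getLast? = some b) := by
  have hsn : w.count s = 0 := List.count_eq_zero_of_not_mem (fun hh => (hs _ hh).false)
  constructor
  · rintro ⟨hab, u, v, h, ha, hb⟩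
    match u, h, ha, hb with
    | [], _, ha, _ => simp at ha
    | c :: u, h, ha, hb =>
      simp only [List.cons_append, List.cons.injEq] at h
      obtain ⟨rfl, h⟩ := h
      rcases split2 h with ⟨v', h1, h2⟩ | ⟨h1, h2⟩ | ⟨u', h1, h2⟩
      · left
        have h1a : s ≠ a := by rintro rfl; exact (hs s (by simp [h1])).false
        have h2a : s ≠ b := by rintro rfl; exact (hs s (by simp [h1])).false
        refine ⟨hab, u, v', h1, ?_, ?_⟩
        · simpa [List.count_cons, h2a] using ha
        · simpa [List.count_cons, h1a] using hb
      · right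
        simp at h2
        obtain ⟨rfl, h2⟩ := h2
        refine ⟨rfl, hab, ?_, ?_⟩
        · rw [h1]; simpa [List.count_cons, hab.ne] using ha
        · simp [h1]
      · have := congrArg List.length h1; simp at this
        omega
  · rintro (⟨hab, u, v, h, ha, hb⟩ | ⟨rfl, hab, h1, h2⟩)
    · have h1 : s ≠ a := by rintro rfl; exact (hs s (by simp [h])).false
      have h2 : s ≠ b := by rintro rfl; exact (hs s (by simp [h])).false
      refine ⟨hab, s :: u, v ++ [s], by simp [h], ?_, ?_⟩
      · simpa [List.count_cons, h2] using ha
      · simpa [List.count_cons, h1] using hb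
    · obtain ⟨u, rfl⟩ := List.getLast?_eq_some_iff.1 h2
      refine ⟨hab, a :: u, [], by simp, ?_, ?_⟩
      · simpa [List.count_cons, hab.ne] using h1
      · simp [hab.ne'] at hsn; simpa using hsn

namespace T
variable {k : ℕ}

theorem word_node (a : ℕ) (c : Fin k) (l m r : T k) :
    word (node a c l m r) = word l ++ ((a :: (word m ++ [a])) ++ word r) := by
  simp [word]

theorem disj1 {a : ℕ} {c : Fin k} {l m r : T k} (h : WF (node a c l m r)) :
    (word l).Disjoint ((a :: (word m ++ [a])) ++ word r) := by
  obtain ⟨a1, a2, a3, d1, d2, d3, w1, w2, w3⟩ := h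
  intro x hx hy
  simp only [List.mem_append, List.mem_cons, mem_word, List.not_mem_nil, or_false] at hx hy
  rw [Finset.disjoint_left] at d1 d2 d3
  have := a1 x hx
  grind

theorem disj2 {a : ℕ} {c : Fin k} {l m r : T k} (h : WF (node a c l m r)) :
    ((a :: (word m ++ [a]))).Disjoint (word r) := by
  obtain ⟨a1, a2, a3, d1, d2, d3, w1, w2, w3⟩ := h
  intro x hx hy
  simp only [List.mem_append, List.mem_cons, mem_word, List.not_mem_nil, or_false] at hx hy
  rw [Finset.disjoint_left] at d1 d2 d3
  have := a3 x hy
  grind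

theorem AAp_mem {w : List ℕ} {a b : ℕ} (h : AAp w a b) : a ∈ w ∧ b ∈ w := by
  obtain ⟨_, u, v, rfl, _⟩ := h; simp
theorem TNp_mem {w : List ℕ} {a b : ℕ} (h : TNp w a b) : a ∈ w ∧ b ∈ w := by
  obtain ⟨_, u, v, rfl, _⟩ := h; simp

theorem AAp_node {s : ℕ} {c : Fin k} {l m r : T k} (h : WF (node s c l m r)) (a b : ℕ) :
    AAp (word (node s c l m r)) a b ↔ AAp (word l) a b ∨ AAp (word m) a b ∨ AAp (word r) a b ∨
      (a = s ∧ (word r).head? = some b) := by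
  obtain ⟨a1, a2, a3, d1, d2, d3, w1, w2, w3⟩ := id h
  rw [word_node, AAp_append (disj1 h), AAp_append (disj2 h),
    AAp_block (fun x hx => a2 x ((mem_word _ _).1 hx))]
  have hsm : (word m).count s = 0 := List.count_eq_zero_of_not_mem
    (fun hh => (a2 _ ((mem_word _ _).1 hh)).false)
  constructor
  · rintro (h | (h | h | ⟨h1, h2, h3, h4⟩) | ⟨h1, h2, h3, h4⟩)
    · tauto
    · tauto
    · tauto
    · have : s = a := by
        rw [← List.cons_append, List.getLast?_append] at h3; simpa using h3
      exact Or.inr (Or.inr (Or.inr ⟨this.symm, h4⟩))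
    · exfalso
      have hb : s = b := by simpa using h4
      have : a ∈ word l := List.count_pos_iff.1 (by omega)
      have := a1 a ((mem_word _ _).1 this)
      omega
  · rintro (h | h | h | ⟨rfl, h9⟩)
    · tauto
    · tauto
    · tauto
    · right; left; right; right
      have : b ∈ word r := List.mem_of_mem_head? h9
      refine ⟨a3 b ((mem_word _ _).1 this), ?_, by rw [← List.cons_append, List.getLast?_append]; simp, h9⟩
      simp [hsm]

theorem TNp_node {s : ℕ} {c : Fin k} {l m r : T k} (h : WF (node s c l m r)) (a b : ℕ) :
    TNp (word (node s c l m r)) a b ↔ TNp (word l) a b ∨ TNp (word m) a b ∨ TNp (word r) a b ∨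
      (a = s ∧ (word m).getLast? = some b) := by
  obtain ⟨a1, a2, a3, d1, d2, d3, w1, w2, w3⟩ := id h
  rw [word_node, TNp_append (disj1 h), TNp_append (disj2 h),
    TNp_block (fun x hx => a2 x ((mem_word _ _).1 hx))]
  have : (word m).getLast? = some b → s < b ∧ (word m).count b = 2 := by
    intro h
    have hb : b ∈ word m := List.mem_of_mem_getLast? h
    rw [mem_word] at hb
    exact ⟨a2 b hb, by rw [count_word _ w2, if_pos hb]⟩
  tauto

theorem AAok_iff (t : T k) (h : WF t) :
    AAok t ↔ ∀ a b, AAp (word t) a b → col t b < col t a := by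
  induction t with
  | nil => simp [AAok, AAp, word]
  | node s c l m r h1 h2 h3 =>
    obtain ⟨a1, a2, a3, d1, d2, d3, w1, w2, w3⟩ := id h
    simp only [AAok, AAp_node h, h1 w1, h2 w2, h3 w3]
    constructor
    · rintro ⟨f, g1, g2, g3⟩ a b (hh | hh | hh | ⟨rfl, hh⟩)
      · have := AAp_mem hh
        simp only [mem_word] at this
        rw [col_l h this.1, col_l h this.2]; exact g1 _ _ hh
      · have := AAp_mem hh
        simp only [mem_word] at this
        rw [col_m h this.1, col_m h this.2]; exact g2 _ _ hh
      · have := AAp_mem hh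
        simp only [mem_word] at this
        rw [col_r h this.1, col_r h this.2]; exact g3 _ _ hh
      · rw [head_word, Option.map_eq_some_iff] at hh
        obtain ⟨p, hp, rfl⟩ := hh
        have := fst_mem r w3 p hp
        rw [col_r h this.1, col_a, this.2]; exact f p hp
    · intro H
      refine ⟨?_, ?_, ?_, ?_⟩
      · intro p hp
        have := fst_mem r w3 p hp
        have := H s p.1 (Or.inr (Or.inr (Or.inr ⟨rfl, by rw [head_word, hp]; rfl⟩)))
        rw [col_r h (fst_mem r w3 p hp).1, col_a, (fst_mem r w3 p hp).2] at this
        exact this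
      · intro a b hh
        have := AAp_mem hh
        simp only [mem_word] at this
        rw [← col_l h this.1, ← col_l h this.2]; exact H _ _ (by tauto)
      · intro a b hh
        have := AAp_mem hh
        simp only [mem_word] at this
        rw [← col_m h this.1, ← col_m h this.2]; exact H _ _ (by tauto)
      · intro a b hh
        have := AAp_mem hh
        simp only [mem_word] at this
        rw [← col_r h this.1, ← col_r h this.2]; exact H _ _ (by tauto)

theorem TNok_iff (t : T k) (h : WF t) :
    TNok t ↔ ∀ a b, TNp (word t) a b → col t b < col t a := by
  induction t with
  | nil => simp [TNok, TNp, word]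
  | node s c l m r h1 h2 h3 =>
    obtain ⟨a1, a2, a3, d1, d2, d3, w1, w2, w3⟩ := id h
    simp only [TNok, TNp_node h, h1 w1, h2 w2, h3 w3]
    constructor
    · rintro ⟨f, g1, g2, g3⟩ a b (hh | hh | hh | ⟨rfl, hh⟩)
      · have := TNp_mem hh
        simp only [mem_word] at this
        rw [col_l h this.1, col_l h this.2]; exact g1 _ _ hh
      · have := TNp_mem hh
        simp only [mem_word] at this
        rw [col_m h this.1, col_m h this.2]; exact g2 _ _ hh
      · have := TNp_mem hh
        simp only [mem_word] at this
        rw [col_r h this.1, col_r h this.2]; exact g3 _ _ hh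
      · rw [last_word, Option.map_eq_some_iff] at hh
        obtain ⟨p, hp, rfl⟩ := hh
        have := lst_mem m w2 p hp
        rw [col_m h this.1, col_a, this.2]; exact f p hp
    · intro H
      refine ⟨?_, ?_, ?_, ?_⟩
      · intro p hp
        have := H s p.1 (Or.inr (Or.inr (Or.inr ⟨rfl, by rw [last_word, hp]; rfl⟩)))
        rw [col_m h (lst_mem m w2 p hp).1, col_a, (lst_mem m w2 p hp).2] at this
        exact this
      · intro a b hh
        have := TNp_mem hh
        simp only [mem_word] at this
        rw [← col_l h this.1, ← col_l h this.2]; exact H _ _ (by tauto)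
      · intro a b hh
        have := TNp_mem hh
        simp only [mem_word] at this
        rw [← col_m h this.1, ← col_m h this.2]; exact H _ _ (by tauto)
      · intro a b hh
        have := TNp_mem hh
        simp only [mem_word] at this
        rw [← col_r h this.1, ← col_r h this.2]; exact H _ _ (by tauto)

end T
end SP

namespace SP

theorem nest_append {x y : List ℕ} (hd : x.Disjoint y) (hx : Nest x) (hy : Nest y) :
    Nest (x ++ y) := by
  intro u a v z he b hb
  rcases List.append_eq_append_iff.1 he with ⟨w, e1, e2⟩ | ⟨w, e1, e2⟩
  · exact hy w a v z e2 b hb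
  · cases w with
    | nil => exact hy [] a v z (by simpa using e2.symm) b hb
    | cons d w =>
      simp at e2
      obtain ⟨rfl, e2⟩ := e2
      rcases List.append_eq_append_iff.1 e2 with ⟨w', e3, e4⟩ | ⟨w', e3, e4⟩
      · cases w' with
        | nil =>
          exfalso
          simp at e4
          exact hd (a := a) (by simp [e1]) (by simp [← e4])
        | cons d w' =>
          simp at e4
          obtain ⟨rfl, e4⟩ := e4
          exact hx u a v w' (by rw [e1, e3]) b hb
      · exfalso
        exact hd (a := a) (by simp [e1]) (by simp [e4])

theorem nest_block {s : ℕ} {w : List ℕ} (hs : ∀ x ∈ w, s < x) (hw : Nest w) :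
    Nest (s :: (w ++ [s])) := by
  have hsn : w.count s = 0 := List.count_eq_zero_of_not_mem (fun hh => (hs _ hh).false)
  intro u a v z he b hb
  cases u with
  | nil =>
    simp at he
    obtain ⟨rfl, he⟩ := he
    have hc := congrArg (List.count s) he
    simp [hsn] at hc
    have hv : s ∉ v := fun h => by
      have := List.count_pos_iff.2 h; omega
    have := (append_cons_inj (fun h => (hs _ h).false) hv he).1
    exact hs b (this ▸ hb)
  | cons d u =>
    simp at he
    obtain ⟨rfl, he⟩ := he
    rcases List.eq_nil_or_concat z with rfl | ⟨z', e, rfl⟩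
    · exfalso
      rw [show u ++ a :: (v ++ [a]) = (u ++ a :: v) ++ [a] by simp] at he
      have h1 := List.append_inj' he rfl
      have : s = a := by simpa using h1.2
      subst this
      have := h1.1
      exact (hs s (by simp [this])).false
    · rw [List.concat_eq_append,
        show u ++ a :: (v ++ a :: (z' ++ [e])) = (u ++ a :: (v ++ a :: z')) ++ [e] by simp] at he
      exact hw u a v z' (List.append_inj' he rfl).1 b hb

theorem no_straddle {p q : List ℕ} {s : ℕ} (h : Nest (p ++ s :: q))
    (hs : ∀ x ∈ p ++ s :: q, s ≤ x) {x : ℕ} (hp : x ∈ p) (hq : x ∈ q) : False := by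
  obtain ⟨p1, p2, rfl⟩ := List.append_of_mem hp
  obtain ⟨q1, q2, rfl⟩ := List.append_of_mem hq
  have h1 := h p1 x (p2 ++ s :: q1) q2 (by simp) s (by simp)
  have h2 := hs x (by simp)
  omega

theorem split_first {w : List ℕ} {s : ℕ} (h : s ∈ w) : ∃ u v, w = u ++ s :: v ∧ s ∉ u := by
  induction w with
  | nil => simp at h
  | cons a w ih =>
    by_cases has : a = s
    · exact ⟨[], w, by simp [has], by simp⟩
    · obtain ⟨u, v, rfl, hu⟩ := ih (by simp at h; tauto)
      exact ⟨a :: u, v, by simp, by simp [hu, Ne.symm has]⟩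

namespace T
variable {k : ℕ}

theorem nest_word (t : T k) (h : WF t) : Nest (word t) := by
  induction t with
  | nil => intro u a v z hw; simp [word] at hw
  | node s c l m r h1 h2 h3 =>
    obtain ⟨a1, a2, a3, d1, d2, d3, w1, w2, w3⟩ := id h
    rw [word_node]
    exact nest_append (disj1 h) (h1 w1) (nest_append (disj2 h)
      (nest_block (fun x hx => a2 x ((mem_word _ _).1 hx)) (h2 w2)) (h3 w3))

theorem stirling_word (t : T k) (h : WF t) : IsStirling (labels t) (word t) :=
  ⟨count_word t h, (nest_iff _).2 (nest_word t h)⟩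

theorem exists_tree (c : ℕ → ℕ) (n : ℕ) : ∀ (S : Finset ℕ) (w : List ℕ), S.card ≤ n →
    IsStirling S w → (∀ a ∈ S, c a < k) →
    ∃ t : T k, WF t ∧ labels t = S ∧ word t = w ∧ ∀ a ∈ S, col t a = c a := by
  have hnil : ∀ w, IsStirling ∅ w → 
    ∃ t : T k, WF t ∧ labels t = ∅ ∧ word t = w ∧ ∀ a ∈ (∅ : Finset ℕ), col t a = c a := by
    intro w hw
    refine ⟨nil, trivial, rfl, ?_, by simp⟩
    symm
    rw [word, List.eq_nil_iff_forall_not_mem]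
    intro a ha
    have := hw.1 a
    simp at this
    have := List.count_pos_iff.2 ha
    omega
  induction n with
  | zero =>
    intro S w hS hw _
    have : S = ∅ := by simpa using hS
    subst this
    exact hnil w hw
  | succ n ih =>
    intro S w hS hw hc
    rcases S.eq_empty_or_nonempty with rfl | hne
    · exact hnil w hw
    obtain ⟨s, hsS, hmin⟩ : ∃ s ∈ S, ∀ x ∈ S, s ≤ x :=
      ⟨S.min' hne, S.min'_mem hne, fun x hx => S.min'_le x hx⟩
    obtain ⟨hcnt, hN⟩ := hw
    rw [nest_iff] at hN
    have hmem : ∀ x, x ∈ w ↔ x ∈ S := by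
      intro x; rw [← List.count_pos_iff, hcnt]; split_ifs <;> simp [*]
    obtain ⟨l, w', rfl, hsl⟩ := split_first ((hmem s).2 hsS)
    have hs2 := hcnt s
    rw [if_pos hsS] at hs2
    simp [List.count_eq_zero_of_not_mem hsl] at hs2
    obtain ⟨m, r, rfl, hsm⟩ := split_first (List.count_pos_iff.1 (by omega : 0 < w'.count s))
    simp [List.count_eq_zero_of_not_mem hsm] at hs2
    have hsr : s ∉ r := List.count_eq_zero.1 hs2
    have hle : ∀ x ∈ l ++ s :: (m ++ s :: r), s ≤ x := fun x hx => hmin x ((hmem x).1 hx)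
    have n1 : ∀ x, x ∈ l → x ∈ m ++ s :: r → False := fun x h1 h2 => no_straddle hN hle h1 h2
    have n2 : ∀ x, x ∈ m → x ∈ r → False := fun x h1 h2 => by
      have e : l ++ s :: (m ++ s :: r) = (l ++ s :: m) ++ s :: r := by simp
      rw [e] at hN hle
      exact no_straddle hN hle (x := x) (by simp [h1]) h2
    have sub : ∀ x, x ∈ l ∨ x ∈ m ∨ x ∈ r → x ∈ S ∧ s < x := by
      intro x hx
      have h1 : x ∈ S := (hmem x).1 (by simp; tauto)
      refine ⟨h1, lt_of_le_of_ne (hmin x h1) ?_⟩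
      rintro rfl; tauto
    have card : ∀ y : List ℕ, (∀ x ∈ y, x ∈ S ∧ s < x) → y.toFinset.card ≤ n := by
      intro y hy
      have : y.toFinset ⊆ S.erase s := by
        intro x hx
        have := hy x (by simpa using hx)
        simp [this.1, this.2.ne']
      have := Finset.card_le_card this
      rw [Finset.card_erase_of_mem hsS] at this
      omega
    have cnt : ∀ x, x ≠ s → (l.count x + m.count x + r.count x = if x ∈ S then 2 else 0) := by
      intro x hx
      rw [← hcnt x]; simp [List.count_cons, Ne.symm hx]; omega
    have Sl : IsStirling l.toFinset l := by
      refine ⟨fun x => ?_, (nest_iff _).2 (nest_infix (u := []) hN)⟩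
      by_cases hx : x ∈ l
      · have h1 := sub x (Or.inl hx)
        have := cnt x h1.2.ne'
        have hm : m.count x = 0 := List.count_eq_zero_of_not_mem (fun h => n1 x hx (by simp [h]))
        have hr : r.count x = 0 := List.count_eq_zero_of_not_mem (fun h => n1 x hx (by simp [h]))
        simp [hm, hr, h1.1] at this; simp [hx, this]
      · simp [hx, List.count_eq_zero_of_not_mem hx]
    have Sm : IsStirling m.toFinset m := by
      refine ⟨fun x => ?_, (nest_iff _).2 (nest_infix (u := l ++ [s]) (v := s :: r) (by simpa using hN))⟩
      by_cases hx : x ∈ m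
      · have h1 := sub x (Or.inr (Or.inl hx))
        have := cnt x h1.2.ne'
        have hm : l.count x = 0 := List.count_eq_zero_of_not_mem (fun h => n1 x h (by simp [hx]))
        have hr : r.count x = 0 := List.count_eq_zero_of_not_mem (fun h => n2 x hx h)
        simp [hm, hr, h1.1] at this; simp [hx, this]
      · simp [hx, List.count_eq_zero_of_not_mem hx]
    have Sr : IsStirling r.toFinset r := by
      refine ⟨fun x => ?_, (nest_iff _).2 (nest_infix (u := l ++ s :: (m ++ [s])) (v := []) (by simpa using hN))⟩
      by_cases hx : x ∈ r
      · have h1 := sub x (Or.inr (Or.inr hx))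
        have := cnt x h1.2.ne'
        have hm : l.count x = 0 := List.count_eq_zero_of_not_mem (fun h => n1 x h (by simp [hx]))
        have hr : m.count x = 0 := List.count_eq_zero_of_not_mem (fun h => n2 x h hx)
        simp [hm, hr, h1.1] at this; simp [hx, this]
      · simp [hx, List.count_eq_zero_of_not_mem hx]
    obtain ⟨tl, wl, ll, el, cl⟩ := ih _ l (card l fun x hx => sub x (by tauto)) Sl
      (fun a ha => hc a (sub a (Or.inl (by simpa using ha))).1)
    obtain ⟨tm, wm, lm, em, cm⟩ := ih _ m (card m fun x hx => sub x (by tauto)) Sm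
      (fun a ha => hc a (sub a (Or.inr (Or.inl (by simpa using ha)))).1)
    obtain ⟨tr, wr, lr, er, cr⟩ := ih _ r (card r fun x hx => sub x (by tauto)) Sr
      (fun a ha => hc a (sub a (Or.inr (Or.inr (by simpa using ha)))).1)
    have W : WF (node s ⟨c s, hc s hsS⟩ tl tm tr) := by
      refine ⟨?_, ?_, ?_, ?_, ?_, ?_, wl, wm, wr⟩
      · rw [ll]; intro x hx; exact (sub x (Or.inl (by simpa using hx))).2
      · rw [lm]; intro x hx; exact (sub x (Or.inr (Or.inl (by simpa using hx)))).2
      · rw [lr]; intro x hx; exact (sub x (Or.inr (Or.inr (by simpa using hx)))).2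
      · rw [ll, lm, Finset.disjoint_left]; intro x hx hy
        simp at hx hy; exact n1 x hx (by simp [hy])
      · rw [ll, lr, Finset.disjoint_left]; intro x hx hy
        simp at hx hy; exact n1 x hx (by simp [hy])
      · rw [lm, lr, Finset.disjoint_left]; intro x hx hy
        simp at hx hy; exact n2 x hx hy
    have L : labels (node s ⟨c s, hc s hsS⟩ tl tm tr) = S := by
      ext x
      rw [← hmem x, ← mem_word, word, el, em, er]
    refine ⟨_, W, L, by rw [word, el, em, er], ?_⟩
    intro a ha
    rw [← L, labels] at ha
    simp only [Finset.mem_insert, Finset.mem_union] at ha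
    rcases ha with rfl | (ha | ha) | ha
    · simp [col_a]
    · rw [col_l W ha]; exact cl a (ll ▸ ha)
    · rw [col_m W ha]; exact cm a (lm ▸ ha)
    · rw [col_r W ha]; exact cr a (lr ▸ ha)

/-- increasing trees on the label set `S` satisfying `P` with content `f` -/
def Tset (k : ℕ) (P : T k → Prop) (S : Finset ℕ) (f : Fin k →₀ ℕ) : Set (T k) :=
  {t | WF t ∧ labels t = S ∧ P t ∧ cont t = f}

theorem card_AA (n k : ℕ) (f : Fin k → ℕ) : Nat.card (QAAset n k f) =
    Nat.card (Tset k AAok (Finset.Icc 1 (n-1)) (Finsupp.equivFunOnFinite.symm f)) := by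
  symm
  refine Nat.card_congr (Equiv.ofBijective (fun t => ⟨(word t.1, col t.1), ?_⟩) ⟨?_, ?_⟩)
  · obtain ⟨t, W, L, A, C⟩ := t
    refine ⟨by have := stirling_word t W; rw [L] at this; exact this, ?_, ?_, ?_, ?_⟩
    · intro a b h; exact (AAok_iff t W).1 A a b ((AApair_iff _ _ _).1 h)
    · intro a ha; exact col_lt t a (L ▸ ha)
    · intro a ha; exact col_notMem t a (L ▸ ha)
    · intro i
      have := card_col t W i
      rw [L, C] at this
      exact this
  · intro t t' h
    simp only [Subtype.mk.injEq, Prod.mk.injEq] at h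
    exact Subtype.ext (inj _ _ t.2.1 t'.2.1 h.1 (congrFun h.2))
  · rintro ⟨⟨w, c⟩, h1, h2, h3, h4, h5⟩
    obtain ⟨t, W, L, E, C⟩ := exists_tree (k := k) c _ _ w le_rfl h1 h3
    have hcol : col t = c := by
      ext a
      by_cases ha : a ∈ Finset.Icc 1 (n-1)
      · exact C a ha
      · rw [col_notMem t a (L ▸ ha)]; exact (h4 a ha).symm
    subst hcol; subst E
    refine ⟨⟨t, W, L, ?_, ?_⟩, rfl⟩
    · rw [AAok_iff t W]; intro a b h; exact h2 a b ((AApair_iff _ _ _).2 h)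
    · ext i; rw [← card_col t W, L]; exact h5 i

theorem card_TN (n k : ℕ) (f : Fin k → ℕ) : Nat.card (QTNset n k f) =
    Nat.card (Tset k TNok (Finset.Icc 1 (n-1)) (Finsupp.equivFunOnFinite.symm f)) := by
  symm
  refine Nat.card_congr (Equiv.ofBijective (fun t => ⟨(word t.1, col t.1), ?_⟩) ⟨?_, ?_⟩)
  · obtain ⟨t, W, L, A, C⟩ := t
    refine ⟨by have := stirling_word t W; rw [L] at this; exact this, ?_, ?_, ?_, ?_⟩
    · intro a b h; exact (TNok_iff t W).1 A a b ((TNpair_iff _ _ _).1 h)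
    · intro a ha; exact col_lt t a (L ▸ ha)
    · intro a ha; exact col_notMem t a (L ▸ ha)
    · intro i
      have := card_col t W i
      rw [L, C] at this
      exact this
  · intro t t' h
    simp only [Subtype.mk.injEq, Prod.mk.injEq] at h
    exact Subtype.ext (inj _ _ t.2.1 t'.2.1 h.1 (congrFun h.2))
  · rintro ⟨⟨w, c⟩, h1, h2, h3, h4, h5⟩
    obtain ⟨t, W, L, E, C⟩ := exists_tree (k := k) c _ _ w le_rfl h1 h3
    have hcol : col t = c := by
      ext a
      by_cases ha : a ∈ Finset.Icc 1 (n-1)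
      · exact C a ha
      · rw [col_notMem t a (L ▸ ha)]; exact (h4 a ha).symm
    subst hcol; subst E
    refine ⟨⟨t, W, L, ?_, ?_⟩, rfl⟩
    · rw [TNok_iff t W]; intro a b h; exact h2 a b ((TNpair_iff _ _ _).2 h)
    · ext i; rw [← card_col t W, L]; exact h5 i

theorem card_rot (k : ℕ) (S : Finset ℕ) (f : Fin k →₀ ℕ) :
    Nat.card (Tset k TNok S f) = Nat.card (Tset k AAok S f) := by
  symm
  refine Nat.card_congr ⟨fun t => ⟨rot t.1, ?_⟩, fun t => ⟨rotInv t.1, ?_⟩, ?_, ?_⟩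
  · obtain ⟨t, h1, h2, h3, h4⟩ := t
    exact ⟨(WF_rot t).2 h1, by rw [labels_rot, h2], (TNok_rot t).2 h3, by rw [cont_rot, h4]⟩
  · obtain ⟨t, h1, h2, h3, h4⟩ := t
    rw [← rot_rotInv t] at h1 h2 h3 h4
    exact ⟨(WF_rot _).1 h1, (labels_rot _).symm.trans h2, (TNok_rot _).1 h3, (cont_rot _).symm.trans h4⟩
  · intro t; simp [rotInv_rot]
  · intro t; simp [rot_rotInv]

end T
end SP

namespace SP

def bconv {R : Type*} [CommRing R] (f g : ℕ → R) (n : ℕ) : R :=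
  ∑ i ∈ Finset.range (n+1), n.choose i • (f i * g (n - i))

theorem sum_powerset_bconv {R : Type*} [CommRing R] {α : Type*} [DecidableEq α] (S : Finset α)
    (f g : ℕ → R) : ∑ T ∈ S.powerset, f T.card * g (S \ T).card = bconv f g S.card := by
  rw [bconv, ← Finset.sum_powerset_apply_card (fun i => f i * g (S.card - i))]
  refine Finset.sum_congr rfl fun T hT => ?_
  rw [Finset.card_sdiff_of_subset (Finset.mem_powerset.1 hT)]

theorem bconv_congr {R : Type*} [CommRing R] {f f' g g' : ℕ → R} {n : ℕ}
    (hf : ∀ i ≤ n, f i = f' i) (hg : ∀ i ≤ n, g i = g' i) : bconv f g n = bconv f' g' n := by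
  refine Finset.sum_congr rfl fun i hi => ?_
  rw [hf i (by simp at hi; omega), hg (n - i) (by omega)]

namespace T
variable {k : ℕ}

theorem finite_trees (n : ℕ) : ∀ S : Finset ℕ, S.card ≤ n → {t : T k | WF t ∧ labels t = S}.Finite := by
  have hnil : {t : T k | WF t ∧ labels t = ∅}.Finite := by
    refine (Set.finite_singleton nil).subset ?_
    rintro t ⟨_, h⟩
    cases t with
    | nil => rfl
    | node => simp [labels] at h
  induction n with
  | zero => intro S hS; have : S = ∅ := by simpa using hS
            subst this; exact hnil
  | succ n ih =>
    intro S hS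
    have hB : (⋃ U ∈ (S.powerset.filter fun U => U.card ≤ n : Finset (Finset ℕ)),
        {t : T k | WF t ∧ labels t = U}).Finite := by
      refine Set.Finite.biUnion (Finset.finite_toSet _) ?_
      intro U hU; exact ih U (by simpa using (Finset.mem_filter.1 hU).2)
    set B := (⋃ U ∈ (S.powerset.filter fun U => U.card ≤ n : Finset (Finset ℕ)),
        {t : T k | WF t ∧ labels t = U}) with hBdef
    have hfin : ((S : Set ℕ) ×ˢ ((Set.univ : Set (Fin k)) ×ˢ (B ×ˢ (B ×ˢ B)))).Finite :=
      (Finset.finite_toSet _).prod (Set.finite_univ.prod (hB.prod (hB.prod hB)))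
    refine ((hfin.image (fun p => node p.1 p.2.1 p.2.2.1 p.2.2.2.1 p.2.2.2.2)).union
      (Set.finite_singleton nil)).subset ?_
    rintro t ⟨W, L⟩
    cases t with
    | nil => right; rfl
    | node a c l m r =>
      left
      obtain ⟨a1, a2, a3, d1, d2, d3, w1, w2, w3⟩ := W
      have key : ∀ u : T k, WF u → (∀ x ∈ labels u, a < x) → labels u ⊆ S → u ∈ B := by
        intro u hu ha hs
        simp only [hBdef, Set.mem_iUnion]
        refine ⟨labels u, ?_, hu, rfl⟩
        have haS : a ∈ S := by rw [← L]; simp [labels]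
        have : labels u ⊆ S.erase a := fun x hx =>
          Finset.mem_erase.2 ⟨(ha x hx).ne', hs hx⟩
        have := Finset.card_le_card this
        rw [Finset.card_erase_of_mem haS] at this
        simp [hs]; omega
      refine ⟨(a, c, l, m, r), ?_, rfl⟩
      refine ⟨?_, trivial, key l w1 a1 ?_, key m w2 a2 ?_, key r w3 a3 ?_⟩
      · simp [← L, labels]
      all_goals
        intro x hx
        simp [← L, labels, hx]

def aaSet (k : ℕ) (S : Finset ℕ) (j : ℕ) : Set (T k) :=
  {t | WF t ∧ labels t = S ∧ AAok t ∧ ∀ p ∈ fst t, (p.2 : ℕ) < j}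

theorem aaSet_finite (S : Finset ℕ) (j : ℕ) : (aaSet k S j).Finite :=
  (finite_trees S.card S le_rfl).subset fun _ h => ⟨h.1, h.2.1⟩

noncomputable def AAT (k : ℕ) (S : Finset ℕ) (j : ℕ) : Finset (T k) := (aaSet_finite S j).toFinset

theorem mem_AAT {S : Finset ℕ} {j : ℕ} {t : T k} : t ∈ AAT k S j ↔
    WF t ∧ labels t = S ∧ AAok t ∧ ∀ p ∈ fst t, (p.2 : ℕ) < j := by
  simp [AAT, aaSet]

noncomputable def AATh (k : ℕ) (S : Finset ℕ) (j : ℕ) (c : Fin k) : Finset (T k) :=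
  if S = ∅ then (if (c : ℕ) < j then {nil} else ∅) else AAT k S j

noncomputable def wt (t : T k) : MvPolynomial (Fin k) ℚ := MvPolynomial.monomial (cont t) 1

theorem wt_node (a c) (l m r : T k) :
    wt (node a c l m r) = MvPolynomial.X c * (wt l * (wt m * wt r)) := by
  simp only [wt, cont, MvPolynomial.X, MvPolynomial.monomial_mul, one_mul, add_assoc]

noncomputable def F (k : ℕ) (S : Finset ℕ) (j : ℕ) : MvPolynomial (Fin k) ℚ := ∑ t ∈ AAT k S j, wt t
noncomputable def Fh (k : ℕ) (S : Finset ℕ) (j : ℕ) (c : Fin k) : MvPolynomial (Fin k) ℚ :=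
  if S = ∅ then (if (c : ℕ) < j then 1 else 0) else F k S j

theorem labels_eq_empty {t : T k} : labels t = ∅ ↔ t = nil := by
  cases t <;> simp [labels]

theorem sum_AATh (S : Finset ℕ) (j : ℕ) (c : Fin k) : ∑ t ∈ AATh k S j c, wt t = Fh k S j c := by
  rw [AATh, Fh, F]; split_ifs <;> simp [wt, cont]

theorem F_empty (j : ℕ) : F k ∅ j = 1 := by
  have : AAT k ∅ j = {nil} := by
    ext t; rw [mem_AAT, labels_eq_empty]
    simp only [Finset.mem_singleton]
    constructor
    · exact fun h => h.2.1
    · rintro rfl; simp [WF, AAok, fst]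
  simp [F, this, wt, cont]

theorem mem_AATh {S : Finset ℕ} {j : ℕ} {c : Fin k} {t : T k} : t ∈ AATh k S j c ↔
    WF t ∧ labels t = S ∧ AAok t ∧ ∀ a, ∀ p ∈ (fst t).or (some (a, c)), (p.2 : ℕ) < j := by
  rw [AATh]
  split_ifs with h1 h2
  · subst h1
    rw [labels_eq_empty, Finset.mem_singleton]
    constructor
    · rintro rfl; simp [WF, AAok, fst, h2]
    · exact fun h => h.2.1
  · subst h1
    rw [labels_eq_empty]
    simp only [Finset.notMem_empty, false_iff]
    rintro ⟨_, rfl, _, h⟩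
    simp [fst] at h; omega
  · rw [mem_AAT]
    have : ∀ t : T k, t ≠ nil → fst t ≠ none := by
      intro t ht
      cases t with
      | nil => simp at ht
      | node a c l m r => simp [fst]
    constructor
    · rintro ⟨W, L, A, B⟩
      refine ⟨W, L, A, ?_⟩
      have hn : t ≠ nil := by rintro rfl; exact h1 L.symm
      obtain ⟨q, hq⟩ := Option.ne_none_iff_exists'.1 (this t hn)
      simpa [hq] using B
    · rintro ⟨W, L, A, B⟩
      refine ⟨W, L, A, ?_⟩
      have hn : t ≠ nil := by rintro rfl; exact h1 L.symm
      obtain ⟨q, hq⟩ := Option.ne_none_iff_exists'.1 (this t hn)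
      simpa [hq] using B

theorem F_rec (a : ℕ) (S : Finset ℕ) (ha : ∀ x ∈ S, a < x) (j : ℕ) :
    F k (insert a S) j = ∑ c : Fin k, MvPolynomial.X c * ∑ S1 ∈ S.powerset, Fh k S1 j c *
      ∑ S2 ∈ (S \ S1).powerset, F k S2 k * F k ((S \ S1) \ S2) c := by
  have key : F k (insert a S) j = ∑ x ∈ ((Finset.univ : Finset (Fin k)).sigma fun c =>
      S.powerset.sigma fun S1 => (S \ S1).powerset.sigma fun S2 =>
        (AATh k S1 j c) ×ˢ (AAT k S2 k ×ˢ AAT k ((S \ S1) \ S2) c)),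
      wt (node a x.1 x.2.2.2.1 x.2.2.2.2.1 x.2.2.2.2.2) := by
    symm
    refine Finset.sum_bij (fun x _ => node a x.1 x.2.2.2.1 x.2.2.2.2.1 x.2.2.2.2.2) ?_ ?_ ?_ ?_
    · rintro ⟨c, S1, S2, l, m, r⟩ hx
      simp only [Finset.mem_sigma, Finset.mem_univ, true_and, Finset.mem_powerset,
        Finset.mem_product, mem_AAT, mem_AATh] at hx
      obtain ⟨h1, h2, ⟨wl, rfl, al, bl⟩, ⟨wm, rfl, am, bm⟩, ⟨wr, lr, ar, br⟩⟩ := hx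
      rw [mem_AAT]
      refine ⟨⟨?_, ?_, ?_, ?_, ?_, ?_, wl, wm, wr⟩, ?_, ⟨br, al, am, ar⟩, bl a⟩
      · intro x hx; exact ha x (h1 hx)
      · intro x hx; exact ha x (Finset.mem_sdiff.1 (h2 hx)).1
      · intro x hx; rw [lr] at hx; exact ha x (Finset.mem_sdiff.1 (Finset.mem_sdiff.1 hx).1).1
      · rw [Finset.disjoint_right]; intro x hx; exact (Finset.mem_sdiff.1 (h2 hx)).2
      · rw [Finset.disjoint_right, lr]; intro x hx
        exact (Finset.mem_sdiff.1 (Finset.mem_sdiff.1 hx).1).2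
      · rw [Finset.disjoint_right, lr]; intro x hx
        exact (Finset.mem_sdiff.1 hx).2
      · rw [labels, lr]
        congr 1
        ext x
        have := @h1 x
        have := @h2 x
        simp only [Finset.mem_union, Finset.mem_sdiff] at *
        tauto
    · rintro ⟨c, S1, S2, l, m, r⟩ hx ⟨c', S1', S2', l', m', r'⟩ hx' h
      simp only [Finset.mem_sigma, Finset.mem_univ, true_and, Finset.mem_powerset,
        Finset.mem_product, mem_AAT, mem_AATh] at hx hx'
      simp only [node.injEq, true_and] at h
      obtain ⟨rfl, rfl, rfl, rfl⟩ := h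
      obtain ⟨h1, h2, ⟨wl, rfl, al, bl⟩, ⟨wm, rfl, am, bm⟩, ⟨wr, lr, ar, br⟩⟩ := hx
      obtain ⟨h1', h2', ⟨wl', rfl, al', bl'⟩, ⟨wm', rfl, am', bm'⟩, ⟨wr', lr', ar', br'⟩⟩ := hx'
      rfl
    · intro t ht
      rw [mem_AAT] at ht
      obtain ⟨W, L, A, B⟩ := ht
      cases t with
      | nil => simp [labels] at L; exact absurd L.symm (Finset.insert_ne_empty _ _)
      | node a' c l m r =>
        obtain ⟨a1, a2, a3, d1, d2, d3, w1, w2, w3⟩ := W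
        have hal : a = a' := by
          have e1 : a ∈ labels (node a' c l m r) := by rw [L]; simp
          have e2 : a' ∈ insert a S := by rw [← L]; simp [labels]
          simp [labels] at e1 e2
          grind
        subst hal
        have hS : labels l ∪ labels m ∪ labels r = S := by
          rw [labels] at L
          have n1 : a ∉ labels l ∪ labels m ∪ labels r := by
            simp only [Finset.mem_union]; rintro ((h|h)|h)
            · exact (a1 a h).false
            · exact (a2 a h).false
            · exact (a3 a h).false
          have n2 : a ∉ S := fun h => (ha a h).false
          rw [← Finset.erase_insert n1, L, Finset.erase_insert n2]
        refine ⟨⟨c, labels l, labels m, l, m, r⟩, ?_, rfl⟩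
        simp only [Finset.mem_sigma, Finset.mem_univ, true_and, Finset.mem_powerset,
          Finset.mem_product, mem_AAT, mem_AATh]
        obtain ⟨A1, A2, A3, A4⟩ := A
        refine ⟨?_, ?_, ⟨w1, A2, ?_⟩, ⟨w2, A3, fun p _ => p.2.2⟩, w3, ?_, A4, A1⟩
        · rw [← hS]; intro x hx; simp [hx]
        · rw [← hS]; intro x hx
          have := Finset.disjoint_right.1 d1 hx
          simp [hx, this]
        · intro a' p hp
          rw [fst] at B
          cases hl : fst l with
          | none => have := B (a, c) (by simp [hl]); simp [hl] at hp; simpa [← hp] using this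
          | some q => have := B q (by simp [hl]); simp [hl] at hp; simpa [← hp] using this
        · rw [← hS]; ext x
          rw [Finset.disjoint_left] at d1 d2 d3
          have := @d1 x
          have := @d2 x
          have := @d3 x
          simp only [Finset.mem_union, Finset.mem_sdiff]
          tauto
    · intros; rfl
  rw [key]
  simp only [Finset.sum_sigma, Finset.sum_product, wt_node, ← Finset.mul_sum, ← Finset.sum_mul]
  simp only [← F.eq_def, sum_AATh]

noncomputable def d (k n j : ℕ) : MvPolynomial (Fin k) ℚ := F k (Finset.range n) j
noncomputable def dh (k : ℕ) (j : ℕ) (c : Fin k) (n : ℕ) : MvPolynomial (Fin k) ℚ :=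
  if n = 0 then (if (c : ℕ) < j then 1 else 0) else d k n j

theorem F_step (n : ℕ) (ih : ∀ U : Finset ℕ, U.card ≤ n → ∀ j, F k U j = d k U.card j)
    (S : Finset ℕ) (hS : S.card = n + 1) (j : ℕ) :
    F k S j = ∑ c : Fin k, MvPolynomial.X c *
      bconv (dh k j c) (bconv (fun i => d k i k) (fun i => d k i c)) n := by
  have hne : S.Nonempty := Finset.card_pos.1 (by omega)
  have hmem := S.min'_mem hne
  have hc : (S.erase (S.min' hne)).card = n := by rw [Finset.card_erase_of_mem hmem]; omega
  have h1 : ∀ x ∈ S.erase (S.min' hne), S.min' hne < x := fun x hx =>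
    lt_of_le_of_ne (S.min'_le x (Finset.mem_of_mem_erase hx)) (Finset.ne_of_mem_erase hx).symm
  have := F_rec (k := k) _ _ h1 j
  rw [Finset.insert_erase hmem] at this
  rw [this]
  generalize S.erase (S.min' hne) = V at hc
  refine Finset.sum_congr rfl fun c _ => ?_
  congr 1
  rw [← hc, ← sum_powerset_bconv]
  refine Finset.sum_congr rfl fun S1 hS1 => ?_
  rw [← sum_powerset_bconv]
  have hl := Finset.card_le_card (Finset.mem_powerset.1 hS1)
  congr 1
  · simp only [Fh, dh, Finset.card_eq_zero]
    rw [ih S1 (by omega) j]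
  · refine Finset.sum_congr rfl fun S2 hS2 => ?_
    have e1 := Finset.card_le_card (Finset.mem_powerset.1 hS2)
    have e2 : (V \ S1).card ≤ V.card := Finset.card_le_card Finset.sdiff_subset
    have e3 : ((V \ S1) \ S2).card ≤ (V \ S1).card := Finset.card_le_card Finset.sdiff_subset
    rw [ih S2 (by omega), ih _ (by omega)]

theorem F_card (n : ℕ) : ∀ U : Finset ℕ, U.card ≤ n → ∀ j, F k U j = d k U.card j := by
  induction n with
  | zero =>
    intro U hU j
    have : U = ∅ := by simpa using hU
    subst this; simp [d]
  | succ n ih =>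
    intro U hU j
    rcases Nat.lt_or_ge n U.card with h | h
    · have hc : U.card = n + 1 := by omega
      rw [F_step n ih U hc, hc, d, F_step n ih (Finset.range (n+1)) (by simp)]
    · exact ih U h j

theorem d_zero (j : ℕ) : d k 0 j = 1 := by simp [d, F_empty]

theorem d_succ (n j : ℕ) : d k (n+1) j = ∑ c : Fin k, MvPolynomial.X c *
      bconv (dh k j c) (bconv (fun i => d k i k) (fun i => d k i c)) n := by
  rw [d, F_step n (F_card n) _ (by simp)]

open Classical in
theorem coeff_d (S : Finset ℕ) (f : Fin k →₀ ℕ) :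
    MvPolynomial.coeff f (d k S.card k) = Nat.card (Tset k AAok S f) := by
  rw [← F_card _ S le_rfl, F, MvPolynomial.coeff_sum]
  simp only [wt, MvPolynomial.coeff_monomial]
  rw [Finset.sum_boole, Nat.cast_inj, Nat.card_eq_card_finite_toFinset
    ((finite_trees S.card S le_rfl).subset fun _ h => ⟨h.1, h.2.1⟩)]
  congr 1
  ext t
  simp only [Finset.mem_filter, mem_AAT, Set.Finite.mem_toFinset, Tset, Set.mem_ofPred_eq]
  have : ∀ p ∈ fst t, (p.2 : ℕ) < k := fun p _ => p.2.2
  tauto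

end T
end SP

namespace SP
open PowerSeries

section egf
variable {R : Type*} [CommRing R] [Algebra ℚ R]

noncomputable def egf (f : ℕ → R) : PowerSeries R := PowerSeries.mk fun n => ((n.factorial : ℚ)⁻¹) • f n

theorem egf_inj {f g : ℕ → R} (h : egf f = egf g) : f = g := by
  ext n
  have := congrArg (PowerSeries.coeff n) h
  simp only [egf, coeff_mk] at this
  have h2 := congrArg (fun x => (n.factorial : ℚ) • x) this
  have hn : (n.factorial : ℚ) ≠ 0 := by positivity
  simpa [smul_smul, hn] using h2

theorem egf_mul (f g : ℕ → R) : egf f * egf g = egf (bconv f g) := by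
  ext n
  rw [coeff_mul, Finset.Nat.sum_antidiagonal_eq_sum_range_succ_mk]
  simp only [egf, coeff_mk, bconv, Finset.smul_sum]
  refine Finset.sum_congr rfl fun i hi => ?_
  have hi : i ≤ n := by simp at hi; omega
  rw [smul_mul_smul_comm, ← Nat.cast_smul_eq_nsmul ℚ, smul_smul]
  congr 1
  rw [Nat.cast_choose ℚ hi]
  have hn : (n.factorial : ℚ) ≠ 0 := by positivity
  field_simp

theorem egf_deriv (f : ℕ → R) : d⁄dX R (egf f) = egf (fun n => f (n+1)) := by
  ext n
  rw [coeff_derivative]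
  simp only [egf, coeff_mk]
  rw [show ((n : R) + 1) = algebraMap ℚ R (n+1) by simp, mul_comm, ← Algebra.smul_def, smul_smul]
  congr 1
  rw [Nat.factorial_succ]; push_cast
  have hn : (n.factorial : ℚ) ≠ 0 := by positivity
  field_simp

theorem egf_sum {ι : Type*} (s : Finset ι) (f : ι → ℕ → R) :
    egf (fun n => ∑ i ∈ s, f i n) = ∑ i ∈ s, egf (f i) := by
  ext n; simp [egf, Finset.smul_sum]

theorem egf_mulc (a : R) (f : ℕ → R) : egf (fun n => a * f n) = C a * egf f := by
  ext n; simp [egf, coeff_C_mul]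

theorem egf_sub (f g : ℕ → R) : egf (fun n => f n - g n) = egf f - egf g := by
  ext n; simp [egf, smul_sub]

theorem egf_zero (f : ℕ → R) : constantCoeff (egf f) = f 0 := by
  simp [egf, ← coeff_zero_eq_constantCoeff_apply]

/-- linear homogeneous ODE systems with zero initial value have only the zero solution -/
theorem ode_unique {ι : Type*} [Fintype ι] (X : ι → PowerSeries R) (A : ι → ι → PowerSeries R)
    (h0 : ∀ i, constantCoeff (X i) = 0)
    (h : ∀ i, d⁄dX R (X i) = ∑ j, A i j * X j) : ∀ i, X i = 0 := by
  have key : ∀ n, ∀ m ≤ n, ∀ i, coeff m (X i) = 0 := by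
    intro n
    induction n with
    | zero => intro m hm i; have : m = 0 := by omega
              subst this; simpa using h0 i
    | succ n ih =>
      intro m hm i
      rcases Nat.lt_or_ge n m with h1 | h1
      · have : m = n + 1 := by omega
        subst this
        have h2 := congrArg (coeff n) (h i)
        rw [coeff_derivative, map_sum] at h2
        have h3 : ∑ j, coeff n (A i j * X j) = 0 := by
          refine Finset.sum_eq_zero fun j _ => ?_
          rw [coeff_mul]
          refine Finset.sum_eq_zero fun p hp => ?_
          rw [ih p.2 (by have := Finset.HasAntidiagonal.mem_antidiagonal.1 hp; omega), mul_zero]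
        rw [h3] at h2
        rw [show ((n : R) + 1) = algebraMap ℚ R (n+1) by simp, mul_comm, ← Algebra.smul_def] at h2
        have h4 := congrArg (fun x => ((n + 1 : ℚ)⁻¹) • x) h2
        have hn : (n + 1 : ℚ) ≠ 0 := by positivity
        simpa [smul_smul, hn] using h4
      · exact ih m h1 i
  intro i; ext n; simpa using key n n le_rfl i

end egf
end SP

namespace SP
open PowerSeries
namespace T
variable {k : ℕ}

/-- signed version of the sequence `d` -/
noncomputable def ds (k j n : ℕ) : MvPolynomial (Fin k) ℚ := (-1) ^ n * d k n j

noncomputable def z (k : ℕ) : ℕ → ℕ → MvPolynomial (Fin k) ℚ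
  | 0, _ => 1
  | n+1, j => ∑ c : Fin k, (if j ≤ (c : ℕ) then MvPolynomial.X c else 0) *
      ∑ i : Fin (n+1), n.choose i • (ds k k i * z k (n - i) c)
termination_by n => n
decreasing_by omega

theorem z_zero (j : ℕ) : z k 0 j = 1 := by rw [z]

theorem z_succ (n j : ℕ) : z k (n+1) j = ∑ c : Fin k,
    (if j ≤ (c : ℕ) then MvPolynomial.X c else 0) * bconv (ds k k) (fun i => z k i c) n := by
  rw [z]
  refine Finset.sum_congr rfl fun c _ => ?_
  rw [bconv, Finset.sum_range]

theorem bconv_sign {R : Type*} [CommRing R] (f g : ℕ → R) (n : ℕ) :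
    (-1) ^ n * bconv f g n = bconv (fun i => (-1) ^ i * f i) (fun i => (-1) ^ i * g i) n := by
  rw [bconv, bconv, Finset.mul_sum]
  refine Finset.sum_congr rfl fun i hi => ?_
  have hi : i ≤ n := by simp at hi; omega
  obtain ⟨m, rfl⟩ := Nat.exists_eq_add_of_le hi
  rw [Nat.add_sub_cancel_left, pow_add, mul_smul_comm]
  congr 1; ring

theorem ds_zero (j : ℕ) : ds k j 0 = 1 := by simp [ds, d_zero]

theorem ds_succ (n j : ℕ) : ds k j (n+1) = ∑ c : Fin k, (-MvPolynomial.X c) *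
    bconv (fun i => ds k j i - (if j ≤ (c : ℕ) then 1 else 0) * (if i = 0 then 1 else 0))
      (bconv (ds k k) (ds k c)) n := by
  rw [ds, d_succ, Finset.mul_sum]
  refine Finset.sum_congr rfl fun c _ => ?_
  have h1 : (fun i => (-1) ^ i * dh k j c i) =
      (fun i => ds k j i - (if j ≤ (c : ℕ) then 1 else 0) * (if i = 0 then 1 else 0)) := by
    ext1 i
    rw [dh]
    by_cases hi : i = 0
    · subst hi
      by_cases hc : (c : ℕ) < j
      · simp [hc, ds_zero, not_le.2 hc]
      · simp [hc, ds_zero, not_lt.1 hc]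
    · simp [hi, ds]
  have h2 : (fun i => (-1) ^ i * bconv (fun i => d k i k) (fun i => d k i c) i) =
      bconv (ds k k) (ds k c) := by
    ext1 i; rw [bconv_sign]; rfl
  rw [← h1, ← h2, ← bconv_sign]; ring

theorem egf_one : egf (fun i => if i = 0 then (1 : MvPolynomial (Fin k) ℚ) else 0) = 1 := by
  ext1 n
  rw [egf, coeff_mk, coeff_one]
  split_ifs with h <;> simp [h]

theorem ds_ode (j : ℕ) : d⁄dX _ (egf (ds k j)) = ∑ c : Fin k, C (-MvPolynomial.X c) *
    ((egf (ds k j) - C (if j ≤ (c : ℕ) then 1 else 0)) * (egf (ds k k) * egf (ds k c))) := by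
  rw [egf_deriv]
  simp only [ds_succ]
  rw [egf_sum]
  refine Finset.sum_congr rfl fun c _ => ?_
  rw [egf_mulc, ← egf_mul, ← egf_mul, egf_sub, egf_mulc, egf_one, mul_one]

theorem z_ode (j : ℕ) : d⁄dX _ (egf (fun i => z k i j)) = ∑ c : Fin k,
    C (if j ≤ (c : ℕ) then MvPolynomial.X c else 0) *
      (egf (ds k k) * egf (fun i => z k i c)) := by
  rw [egf_deriv]
  simp only [z_succ]
  rw [egf_sum]
  refine Finset.sum_congr rfl fun c _ => ?_
  rw [egf_mulc, ← egf_mul]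

theorem main_ode (j : ℕ) :
    d⁄dX _ (egf (fun i => z k i 0) * egf (ds k j) - egf (fun i => z k i j)) =
    ∑ c : Fin k, (C (MvPolynomial.X c) * egf (ds k k) *
      (C (if j ≤ (c : ℕ) then 1 else 0) - egf (ds k j))) *
      (egf (fun i => z k i 0) * egf (ds k c) - egf (fun i => z k i c)) := by
  rw [map_sub, Derivation.leibniz, ds_ode, z_ode, z_ode, smul_eq_mul, smul_eq_mul,
    Finset.mul_sum, Finset.mul_sum, ← Finset.sum_add_distrib, ← Finset.sum_sub_distrib]
  refine Finset.sum_congr rfl fun c _ => ?_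
  rw [if_pos (Nat.zero_le (c : ℕ))]
  split_ifs with h <;> simp <;> ring

theorem sol (j : ℕ) : egf (fun i => z k i 0) * egf (ds k j) - egf (fun i => z k i j) = 0 := by
  have h0 : ∀ j, constantCoeff (egf (fun i => z k i 0) * egf (ds k j) - egf (fun i => z k i j)) = 0 := by
    intro j; simp [egf_zero, z_zero, ds_zero]
  have h := ode_unique (fun c : Fin k => egf (fun i => z k i 0) * egf (ds k c) - egf (fun i => z k i c))
    _ (fun c => h0 c) (fun c => main_ode (c : ℕ))
  refine ode_unique (fun _ : Unit => egf (fun i => z k i 0) * egf (ds k j) - egf (fun i => z k i j))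
    (fun _ _ => 0) (fun _ => h0 j) (fun _ => ?_) ()
  rw [main_ode]
  simp only [zero_mul, Finset.sum_const_zero]
  refine Finset.sum_eq_zero fun c _ => ?_
  rw [h c, mul_zero]

theorem z_last (n : ℕ) : z k n k = if n = 0 then 1 else 0 := by
  cases n with
  | zero => simp [z_zero]
  | succ n =>
    rw [z_succ, if_neg (Nat.succ_ne_zero n)]
    refine Finset.sum_eq_zero fun c _ => ?_
    rw [if_neg (by have := c.2; omega), zero_mul]

theorem inv_rel (n : ℕ) : bconv (ds k k) (fun i => z k i 0) n = if n = 0 then 1 else 0 := by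
  have h := sol (k := k) k
  simp only [z_last] at h
  rw [sub_eq_zero, mul_comm, egf_mul] at h
  exact congrFun (egf_inj h) n

end T
end SP

namespace SP
namespace T
variable {k : ℕ}

/-- complete homogeneous polynomials in the variables with index at least `j` -/
noncomputable def hh (k : ℕ) : ℕ → ℕ → MvPolynomial (Fin k) ℚ
  | 0, _ => 1
  | t+1, j => ∑ c : Fin k, (if j ≤ (c : ℕ) then MvPolynomial.X c else 0) * hh k t c

theorem deg_sub_single (u : Fin k →₀ ℕ) (c : Fin k) (h : u c ≠ 0) :
    ∑ i, (u - Finsupp.single c 1 : Fin k →₀ ℕ) i + 1 = ∑ i, u i := by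
  classical
  rw [← Finset.add_sum_erase _ _ (Finset.mem_univ c), ← Finset.add_sum_erase _ _ (Finset.mem_univ c)]
  have : ∑ x ∈ Finset.univ.erase c, (u - Finsupp.single c 1 : Fin k →₀ ℕ) x = ∑ x ∈ Finset.univ.erase c, u x := by
    refine Finset.sum_congr rfl fun x hx => ?_
    have := Finset.ne_of_mem_erase hx
    simp [Finsupp.single_apply, this.symm]
  rw [this]
  simp
  omega

open Classical in
theorem coeff_hh (t : ℕ) : ∀ (j : ℕ) (u : Fin k →₀ ℕ), MvPolynomial.coeff u (hh k t j) =
    if ∑ i, u i = t ∧ ∀ i, u i ≠ 0 → j ≤ (i : ℕ) then 1 else 0 := by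
  induction t with
  | zero =>
    intro j u
    rw [hh, MvPolynomial.coeff_one]
    congr 1
    simp only [eq_iff_iff]
    constructor
    · rintro rfl; simp
    · rintro ⟨h, -⟩
      ext i
      have := (Finset.sum_eq_zero_iff.1 h) i (Finset.mem_univ i)
      simp [this]
  | succ t ih =>
    intro j u
    rw [hh, MvPolynomial.coeff_sum]
    have key : ∀ c : Fin k, MvPolynomial.coeff u
        ((if j ≤ (c : ℕ) then MvPolynomial.X c else 0) * hh k t c) =
        if (∑ i, u i = t + 1 ∧ ∀ i, u i ≠ 0 → j ≤ (i : ℕ)) ∧ (u c ≠ 0 ∧ ∀ i, u i ≠ 0 → c ≤ i)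
        then 1 else 0 := by
      intro c
      by_cases hj : j ≤ (c : ℕ)
      · rw [if_pos hj, MvPolynomial.coeff_X_mul']
        by_cases hc : u c = 0
        · simp [hc]
        · rw [if_pos (by simpa using hc), ih]
          congr 1
          have := deg_sub_single u c hc
          simp only [eq_iff_iff]
          constructor
          · rintro ⟨h1, h2⟩
            have h3 : ∀ i, u i ≠ 0 → c ≤ i := by
              intro i hi
              by_cases hic : c = i
              · exact hic.le
              · exact h2 i (by simpa [Finsupp.single_apply, hic] using hi)
            exact ⟨⟨by omega, fun i hi => hj.trans (h3 i hi)⟩, hc, h3⟩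
          · rintro ⟨⟨h1, h2⟩, -, h3⟩
            refine ⟨by omega, fun i hi => h3 i ?_⟩
            intro h; simp [h] at hi
      · rw [if_neg hj, zero_mul, MvPolynomial.coeff_zero, if_neg]
        rintro ⟨⟨-, h⟩, h2, -⟩
        exact hj (h c h2)
    rw [Finset.sum_congr rfl fun c _ => key c]
    split_ifs with h
    · have hne : u.support.Nonempty := by
        rw [Finsupp.support_nonempty_iff]
        rintro rfl
        simp at h
      rw [Finset.sum_eq_single (u.support.min' hne), if_pos]
      · have := u.support.min'_mem hne
        refine ⟨h, by simpa using this, fun i hi => u.support.min'_le i (by simpa using hi)⟩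
      · intro b _ hb
        rw [if_neg]
        rintro ⟨-, h1, h2⟩
        refine hb (le_antisymm (h2 _ ?_) (u.support.min'_le b (by simpa using h1)))
        have := u.support.min'_mem hne
        simpa using this
      · simp
    · simp [h]

theorem cont_deg : ∀ t : T k, WF t → ∑ i, cont t i = (labels t).card := by
  intro t
  induction t with
  | nil => simp [cont, labels]
  | node a c l m r ihl ihm ihr =>
    rintro ⟨a1, a2, a3, d1, d2, d3, w1, w2, w3⟩
    rw [labels, Finset.card_insert_of_notMem, Finset.card_union_of_disjoint,
      Finset.card_union_of_disjoint d1, ← ihl w1, ← ihm w2, ← ihr w3]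
    · simp [cont, Finset.sum_add_distrib, Finsupp.single_apply]
      try omega
    · rw [Finset.disjoint_union_left]; exact ⟨d2, d3⟩
    · simp only [Finset.mem_union]; rintro ((h|h)|h)
      · exact (a1 a h).false
      · exact (a2 a h).false
      · exact (a3 a h).false

theorem coeff_d_deg (m : ℕ) (f : Fin k →₀ ℕ) (h : ∑ i, f i ≠ m) :
    MvPolynomial.coeff f (d k m k) = 0 := by
  have := coeff_d (k := k) (Finset.range m) f
  rw [Finset.card_range] at this
  rw [this]
  have : Tset k AAok (Finset.range m) f = ∅ := by
    ext t
    simp only [Tset, Set.mem_ofPred_eq, Set.mem_empty_iff_false, iff_false]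
    rintro ⟨W, L, -, rfl⟩
    exact h (by rw [cont_deg t W, L, Finset.card_range])
  simp [this]

noncomputable def fs (w : Fin k → ℕ) : Fin k →₀ ℕ := Finsupp.equivFunOnFinite.symm w
@[simp] theorem fs_apply (w : Fin k → ℕ) (i) : fs w i = w i := rfl

/-- the conjectural Möbius value of a block of weight `w` -/
noncomputable def nu (w : Fin k → ℕ) : ℚ := MvPolynomial.coeff (fs w) (ds k k (WP.wsum w))

theorem coeff_ds (m j : ℕ) (f : Fin k →₀ ℕ) : MvPolynomial.coeff f (ds k j m) =
    (-1) ^ m * MvPolynomial.coeff f (d k m j) := by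
  rw [ds, show ((-1 : MvPolynomial (Fin k) ℚ) ^ m) = MvPolynomial.C ((-1) ^ m) by simp,
    MvPolynomial.coeff_C_mul]

theorem sum_nu (m : ℕ) : ∑ w ∈ Finset.piAntidiag (Finset.univ : Finset (Fin k)) m,
    MvPolynomial.monomial (fs w) (nu w) = ds k k m := by
  classical
  ext u
  rw [MvPolynomial.coeff_sum]
  simp only [MvPolynomial.coeff_monomial]
  by_cases h : ∑ i, u i = m
  · rw [Finset.sum_eq_single (u : Fin k → ℕ)]
    · have : fs (u : Fin k → ℕ) = u := by ext; rfl
      rw [if_pos this, nu, this, WP.wsum, h]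
    · intro b _ hb
      rw [if_neg]
      rintro rfl; exact hb rfl
    · intro h2
      exact absurd (Finset.mem_piAntidiag.2 ⟨h, by simp⟩) h2
  · rw [coeff_ds, coeff_d_deg m u h, mul_zero]
    refine Finset.sum_eq_zero fun w hw => ?_
    rw [if_neg]
    rintro rfl
    exact h (Finset.mem_piAntidiag.1 hw).1

theorem nu_zero : nu (fun _ : Fin k => 0) = 1 := by
  have : fs (fun _ : Fin k => 0) = 0 := by ext; rfl
  simp [nu, this, WP.wsum, ds_zero]

end T
end SP

namespace SP
open T
variable {n k : ℕ}

/-- weighted partitions of the subset `B` -/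
def IsPart (B : Finset (Fin n)) (c : WP n k) : Prop :=
  (∀ p ∈ c, p.1.Nonempty) ∧
  (∀ p ∈ c, ∀ q ∈ c, p ≠ q → Disjoint p.1 q.1) ∧
  (∀ x : Fin n, x ∈ B ↔ ∃ p ∈ c, x ∈ p.1) ∧
  (∀ p ∈ c, WP.wsum p.2 + 1 = p.1.card)

theorem isPart_univ (c : WP n k) : IsPart Finset.univ c ↔ WP.IsWP c := by
  simp [IsPart, WP.IsWP]

open Classical in
noncomputable def Parts (k : ℕ) (B : Finset (Fin n)) : Finset (WP n k) :=
  ((Finset.univ : Finset (Finset (Fin n))) ×ˢ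
    (Fintype.piFinset fun _ : Fin k => Finset.range (n+1))).powerset.filter (IsPart B)

theorem mem_Parts {B : Finset (Fin n)} {c : WP n k} : c ∈ Parts k B ↔ IsPart B c := by
  classical
  rw [Parts, Finset.mem_filter, and_iff_right_iff_imp]
  intro h
  rw [Finset.mem_powerset]
  intro p hp
  rw [Finset.mem_product]
  refine ⟨Finset.mem_univ _, ?_⟩
  rw [Fintype.mem_piFinset]
  intro i
  have h1 := h.2.2.2 p hp
  have h2 : p.2 i ≤ WP.wsum p.2 := Finset.single_le_sum (f := p.2) (fun _ _ => Nat.zero_le _) (Finset.mem_univ i)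
  have h3 : p.1.card ≤ n := by simpa using Finset.card_le_univ p.1
  rw [Finset.mem_range]; omega

theorem Parts_empty : Parts k (∅ : Finset (Fin n)) = {∅} := by
  ext c
  rw [mem_Parts, Finset.mem_singleton]
  constructor
  · rintro ⟨h1, h2, h3, h4⟩
    rw [Finset.eq_empty_iff_forall_notMem]
    intro p hp
    obtain ⟨x, hx⟩ := h1 p hp
    exact absurd ((h3 x).2 ⟨p, hp, hx⟩) (Finset.notMem_empty x)
  · rintro rfl; simp [IsPart]

theorem notMem_part {B : Finset (Fin n)} {c : WP n k} (h : IsPart B c) {a : Fin n} (ha : a ∉ B)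
    {p} (hp : p ∈ c) : a ∉ p.1 := fun h' => ha ((h.2.2.1 a).2 ⟨p, hp, h'⟩)

theorem sum_Parts_insert {M : Type*} [AddCommMonoid M] (G : WP n k → M) (a : Fin n)
    (B : Finset (Fin n)) (ha : a ∉ B) :
    ∑ c ∈ Parts k (insert a B), G c = ∑ U ∈ B.powerset,
      ∑ w ∈ Finset.piAntidiag (Finset.univ : Finset (Fin k)) U.card,
        ∑ c ∈ Parts k (B \ U), G (insert (insert a U, w) c) := by
  symm
  rw [Finset.sum_sigma', Finset.sum_sigma']
  refine Finset.sum_bij (fun x _ => insert (insert a x.1.1, x.1.2) x.2) ?_ ?_ ?_ ?_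
  · rintro ⟨⟨U, w⟩, c⟩ hx
    simp only [Finset.mem_sigma, Finset.mem_powerset, Finset.mem_piAntidiag, mem_Parts] at hx
    obtain ⟨⟨hU, hw, -⟩, h1, h2, h3, h4⟩ := hx
    have hdis : ∀ p ∈ c, Disjoint (insert a U) p.1 := by
      intro p hp
      rw [Finset.disjoint_right]
      intro x hx
      have := (h3 x).2 ⟨p, hp, hx⟩
      rw [Finset.mem_sdiff] at this
      rw [Finset.mem_insert, not_or]
      exact ⟨fun e => ha (e ▸ this.1), this.2⟩
    rw [mem_Parts]
    refine ⟨?_, ?_, ?_, ?_⟩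
    · intro p hp
      rcases Finset.mem_insert.1 hp with rfl | hp
      · exact Finset.insert_nonempty _ _
      · exact h1 p hp
    · intro p hp q hq hpq
      rcases Finset.mem_insert.1 hp with rfl | hp <;> rcases Finset.mem_insert.1 hq with rfl | hq
      · exact absurd rfl hpq
      · exact hdis q hq
      · exact (hdis p hp).symm
      · exact h2 p hp q hq hpq
    · intro x
      simp only [Finset.mem_insert, exists_eq_or_imp]
      rw [← h3 x, Finset.mem_sdiff]
      have := @hU x
      tauto
    · intro p hp
      rcases Finset.mem_insert.1 hp with rfl | hp
      · rw [Finset.card_insert_of_notMem (fun h => ha (hU h))]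
        simpa [WP.wsum] using hw
      · exact h4 p hp
  · rintro ⟨⟨U, w⟩, c⟩ hx ⟨⟨U', w'⟩, c'⟩ hx' h
    simp only [Finset.mem_sigma, Finset.mem_powerset, Finset.mem_piAntidiag, mem_Parts] at hx hx' h
    obtain ⟨⟨hU, -⟩, hp⟩ := hx
    obtain ⟨⟨hU', -⟩, hp'⟩ := hx'
    have n1 : ∀ p ∈ c, a ∉ p.1 := fun p hpc => notMem_part hp (fun h => ha (Finset.mem_sdiff.1 h).1) hpc
    have n2 : ∀ p ∈ c', a ∉ p.1 := fun p hpc => notMem_part hp' (fun h => ha (Finset.mem_sdiff.1 h).1) hpc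
    have e : (insert a U, w) = (insert a U', w') := by
      have : (insert a U, w) ∈ insert (insert a U', w') c' := by rw [← h]; simp
      rcases Finset.mem_insert.1 this with e | e
      · exact e
      · exact absurd (Finset.mem_insert_self a U) (n2 _ e)
    rw [Prod.mk.injEq] at e
    obtain ⟨e1, rfl⟩ := e
    have e2 : U = U' := by
      rw [← Finset.erase_insert (fun h => ha (hU h)), e1, Finset.erase_insert (fun h => ha (hU' h))]
    subst e2
    have e3 : c = c' := by
      rw [← Finset.erase_insert (s := c) (a := (insert a U, w)) (fun h => n1 _ h (Finset.mem_insert_self a U)), h,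
        Finset.erase_insert (fun h => n2 _ h (Finset.mem_insert_self a U))]
    subst e3
    rfl
  · intro c hc
    rw [mem_Parts] at hc
    obtain ⟨h1, h2, h3, h4⟩ := hc
    obtain ⟨p, hp, hap⟩ := (h3 a).1 (Finset.mem_insert_self a B)
    refine ⟨⟨⟨p.1.erase a, p.2⟩, c.erase p⟩, ?_, ?_⟩
    · simp only [Finset.mem_sigma, Finset.mem_powerset, Finset.mem_piAntidiag, mem_Parts]
      refine ⟨⟨?_, ?_, by simp⟩, ?_, ?_, ?_, ?_⟩
      · intro x hx
        have := (h3 x).2 ⟨p, hp, Finset.mem_of_mem_erase hx⟩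
        exact (Finset.mem_insert.1 this).resolve_left (Finset.ne_of_mem_erase hx)
      · have := h4 p hp
        rw [Finset.card_erase_of_mem hap, ← this]; simp [WP.wsum]
      · intro q hq; exact h1 q (Finset.mem_of_mem_erase hq)
      · intro q hq r hr; exact h2 q (Finset.mem_of_mem_erase hq) r (Finset.mem_of_mem_erase hr)
      · intro x
        constructor
        · intro hx
          rw [Finset.mem_sdiff, Finset.mem_erase] at hx
          obtain ⟨q, hq, hxq⟩ := (h3 x).1 (Finset.mem_insert_of_mem hx.1)
          refine ⟨q, Finset.mem_erase.2 ⟨?_, hq⟩, hxq⟩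
          rintro rfl
          exact hx.2 ⟨fun e => ha (e ▸ hx.1), hxq⟩
        · rintro ⟨q, hq, hxq⟩
          have hq' := Finset.mem_of_mem_erase hq
          have hd := h2 q hq' p hp (Finset.ne_of_mem_erase hq)
          have hxp := Finset.disjoint_left.1 hd hxq
          have := (h3 x).2 ⟨q, hq', hxq⟩
          rw [Finset.mem_sdiff]
          refine ⟨(Finset.mem_insert.1 this).resolve_left ?_, fun h => hxp (Finset.mem_of_mem_erase h)⟩
          rintro rfl; exact hxp hap
      · intro q hq; exact h4 q (Finset.mem_of_mem_erase hq)
    · simp only [Finset.insert_erase hap, Prod.mk.eta]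
      exact Finset.insert_erase hp
  · intros; rfl

noncomputable def N (p : Finset (Fin n) × (Fin k → ℕ)) : MvPolynomial (Fin k) ℚ :=
  MvPolynomial.monomial (fs p.2) (nu p.2)

theorem sum_Parts_phi (φ : ℕ → MvPolynomial (Fin k) ℚ) (a : Fin n)
    (B : Finset (Fin n)) (ha : a ∉ B) :
    ∑ c ∈ Parts k (insert a B), φ c.card * ∏ p ∈ c, N p = ∑ U ∈ B.powerset,
      ds k k U.card * ∑ c ∈ Parts k (B \ U), φ (c.card + 1) * ∏ p ∈ c, N p := by
  rw [sum_Parts_insert _ a B ha]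
  refine Finset.sum_congr rfl fun U hU => ?_
  rw [← sum_nu, Finset.sum_mul]
  refine Finset.sum_congr rfl fun w hw => ?_
  rw [Finset.mul_sum]
  refine Finset.sum_congr rfl fun c hc => ?_
  have : (insert a U, w) ∉ c := by
    intro h
    exact notMem_part (mem_Parts.1 hc) (fun h => ha (Finset.mem_sdiff.1 h).1) h (Finset.mem_insert_self a U)
  rw [Finset.card_insert_of_notMem this, Finset.prod_insert this, N]
  ring

theorem Z_eq (m : ℕ) : ∀ (B : Finset (Fin n)), B.card ≤ m → ∀ j,
    ∑ c ∈ Parts k B, hh k c.card j * ∏ p ∈ c, N p = z k B.card j := by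
  induction m with
  | zero =>
    intro B hB j
    have : B = ∅ := by simpa using hB
    subst this
    simp [Parts_empty, hh, z_zero]
  | succ m ih =>
    intro B hB j
    rcases B.eq_empty_or_nonempty with rfl | ⟨a, ha⟩
    · simp [Parts_empty, hh, z_zero]
    · obtain ⟨B, haB, rfl⟩ : ∃ B', a ∉ B' ∧ insert a B' = B :=
        ⟨B.erase a, Finset.notMem_erase a B, Finset.insert_erase ha⟩
      rw [Finset.card_insert_of_notMem haB] at hB ⊢
      rw [sum_Parts_phi (fun t => hh k t j) a B haB, z_succ]
      have inner : ∀ U ∈ B.powerset,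
          ds k k U.card * ∑ c ∈ Parts k (B \ U), hh k (c.card + 1) j * ∏ p ∈ c, N p =
          ∑ x : Fin k, (if j ≤ (x : ℕ) then MvPolynomial.X x else 0) *
            (ds k k U.card * z k (B \ U).card x) := by
        intro U hU
        have hc : (B \ U).card ≤ m := (Finset.card_le_card Finset.sdiff_subset).trans (by omega)
        simp only [← ih _ hc, hh, Finset.sum_mul, Finset.mul_sum]
        rw [Finset.sum_comm]
        refine Finset.sum_congr rfl fun x _ => Finset.sum_congr rfl fun c _ => ?_
        ring
      rw [Finset.sum_congr rfl inner, Finset.sum_comm]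
      refine Finset.sum_congr rfl fun x _ => ?_
      rw [← Finset.mul_sum, sum_powerset_bconv B (ds k k) (fun i => z k i x)]

theorem poly_vanish (B : Finset (Fin n)) (hB : 2 ≤ B.card) :
    ∑ c ∈ Parts k B, hh k (c.card - 1) 0 * ∏ p ∈ c, N p = 0 := by
  obtain ⟨a, ha⟩ : B.Nonempty := Finset.card_pos.1 (by omega)
  obtain ⟨B, haB, rfl⟩ : ∃ B', a ∉ B' ∧ insert a B' = B :=
    ⟨B.erase a, Finset.notMem_erase a B, Finset.insert_erase ha⟩
  rw [Finset.card_insert_of_notMem haB] at hB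
  rw [sum_Parts_phi (fun t => hh k (t-1) 0) a B haB]
  simp only [Nat.add_sub_cancel]
  have := inv_rel (k := k) B.card
  rw [if_neg (by omega), ← sum_powerset_bconv] at this
  rw [← this]
  refine Finset.sum_congr rfl fun U _ => ?_
  rw [Z_eq _ _ le_rfl]

theorem prod_N (c : WP n k) : ∏ p ∈ c, N p =
    MvPolynomial.monomial (fs fun i => ∑ p ∈ c, p.2 i) (∏ p ∈ c, nu p.2) := by
  classical
  induction c using Finset.induction_on with
  | empty =>
    have : fs (fun _ : Fin k => 0) = 0 := by ext; rfl
    simp [this]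
  | insert p c hp ih =>
    rw [Finset.prod_insert hp, ih, N, MvPolynomial.monomial_mul, Finset.prod_insert hp]
    have e : fs p.2 + fs (fun i => ∑ p ∈ c, p.2 i) = fs (fun i => ∑ p ∈ insert p c, p.2 i) := by
      ext i
      simp [Finset.sum_insert hp]
    rw [e]

theorem card_part {B : Finset (Fin n)} {c : WP n k} (h : IsPart B c) :
    ∑ p ∈ c, p.1.card = B.card := by
  have : B = c.biUnion fun p => p.1 := by
    ext x; rw [h.2.2.1 x]; simp
  rw [this, Finset.card_biUnion]
  exact fun p hp q hq hpq => h.2.1 p hp q hq hpq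

theorem wsum_part {B : Finset (Fin n)} {c : WP n k} (h : IsPart B c) :
    (∑ i, ∑ p ∈ c, p.2 i) + c.card = B.card := by
  rw [← card_part h, Finset.sum_comm, Finset.card_eq_sum_ones, ← Finset.sum_add_distrib]
  exact Finset.sum_congr rfl fun p hp => h.2.2.2 p hp

open Classical in
theorem vanish (B : Finset (Fin n)) (hB : 2 ≤ B.card) (w : Fin k → ℕ)
    (hw : WP.wsum w + 1 = B.card) :
    ∑ c ∈ (Parts k B).filter (fun c => ∀ i, ∑ p ∈ c, p.2 i ≤ w i), ∏ p ∈ c, nu p.2 = 0 := by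
  have h := congrArg (MvPolynomial.coeff (fs w)) (poly_vanish (k := k) B hB)
  rw [MvPolynomial.coeff_sum, MvPolynomial.coeff_zero] at h
  rw [Finset.sum_filter, ← h]
  refine Finset.sum_congr rfl fun c hc => ?_
  rw [mem_Parts] at hc
  rw [prod_N, MvPolynomial.coeff_mul_monomial']
  have e : (fs (fun i => ∑ p ∈ c, p.2 i) ≤ fs w) ↔ ∀ i, ∑ p ∈ c, p.2 i ≤ w i := Iff.rfl
  rw [if_congr e rfl rfl]
  split_ifs with h1
  · rw [coeff_hh, if_pos, one_mul]
    refine ⟨?_, fun _ _ => Nat.zero_le _⟩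
    have h2 := wsum_part hc
    have h3 : ∑ i, (fs w - fs (fun i => ∑ p ∈ c, p.2 i) : Fin k →₀ ℕ) i + ∑ i, ∑ p ∈ c, p.2 i = WP.wsum w := by
      rw [← Finset.sum_add_distrib]
      refine Finset.sum_congr rfl fun i _ => ?_
      have := h1 i
      simp only [Finsupp.coe_tsub, Pi.sub_apply, fs_apply]
      omega
    have : c.card ≠ 0 := by
      intro h0
      rw [Finset.card_eq_zero] at h0
      subst h0
      have := card_part hc
      simp at this; omega
    omega
  · exact h

end SP

namespace SP
open T WP
variable {n k : ℕ}

theorem part_filter {c b : WP n k} (hc : IsWP c) (hb : IsWP b)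
    (hr : ∀ p ∈ c, ∃ q ∈ b, p.1 ⊆ q.1) {q} (hq : q ∈ b) :
    IsPart q.1 (c.filter fun p => p.1 ⊆ q.1) := by
  obtain ⟨h1, h2, h3, h4⟩ := hc
  refine ⟨fun p hp => h1 p (Finset.mem_filter.1 hp).1,
    fun p hp r hr => h2 p (Finset.mem_filter.1 hp).1 r (Finset.mem_filter.1 hr).1, ?_,
    fun p hp => h4 p (Finset.mem_filter.1 hp).1⟩
  intro x
  constructor
  · intro hx
    obtain ⟨p, hp, hxp⟩ := h3 x
    obtain ⟨q', hq', hs⟩ := hr p hp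
    have : q' = q := by
      by_contra hne
      exact Finset.disjoint_left.1 (hb.2.1 q' hq' q hq hne) (hs hxp) hx
    subst this
    exact ⟨p, Finset.mem_filter.2 ⟨hp, hs⟩, hxp⟩
  · rintro ⟨p, hp, hx⟩
    exact (Finset.mem_filter.1 hp).2 hx

theorem card_pos_of_part {B : Finset (Fin n)} {c : WP n k} (h : IsPart B c) (hB : B.Nonempty) :
    0 < c.card := by
  obtain ⟨x, hx⟩ := hB
  obtain ⟨p, hp, -⟩ := (h.2.2.1 x).1 hx
  exact Finset.card_pos.2 ⟨p, hp⟩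

theorem le_intro {c b : WP n k} (hc : IsWP c) (hb : IsWP b)
    (hr : ∀ p ∈ c, ∃ q ∈ b, p.1 ⊆ q.1)
    (hs : ∀ q ∈ b, ∀ i, (∑ p ∈ c.filter (fun p => p.1 ⊆ q.1), p.2 i) ≤ q.2 i) : WP.le c b := by
  refine ⟨hc, hb, hr, fun q hq => ⟨hs q hq, ?_⟩⟩
  have h1 := wsum_part (part_filter hc hb hr hq)
  have h2 := hb.2.2.2 q hq
  have h3 : ∑ i, (q.2 i - ∑ p ∈ c.filter (fun p => p.1 ⊆ q.1), p.2 i) +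
      ∑ i, ∑ p ∈ c.filter (fun p => p.1 ⊆ q.1), p.2 i = wsum q.2 := by
    rw [← Finset.sum_add_distrib]
    exact Finset.sum_congr rfl fun i _ => Nat.sub_add_cancel (hs q hq i)
  omega

theorem isWP_bot : IsWP (WP.bot n k) := by
  refine ⟨?_, ?_, ?_, ?_⟩
  · intro p hp
    obtain ⟨x, -, rfl⟩ := Finset.mem_image.1 hp
    simp
  · intro p hp q hq hpq
    obtain ⟨x, -, rfl⟩ := Finset.mem_image.1 hp
    obtain ⟨y, -, rfl⟩ := Finset.mem_image.1 hq
    simp only [Finset.disjoint_singleton]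
    rintro rfl; exact hpq rfl
  · intro x
    exact ⟨_, Finset.mem_image.2 ⟨x, Finset.mem_univ x, rfl⟩, by simp⟩
  · intro p hp
    obtain ⟨x, -, rfl⟩ := Finset.mem_image.1 hp
    simp [wsum]

theorem bot_le {b : WP n k} (hb : IsWP b) : WP.le (WP.bot n k) b := by
  refine le_intro isWP_bot hb ?_ ?_
  · intro p hp
    obtain ⟨x, -, rfl⟩ := Finset.mem_image.1 hp
    obtain ⟨q, hq, hx⟩ := hb.2.2.1 x
    exact ⟨q, hq, by simpa using hx⟩
  · intro q hq i
    rw [Finset.sum_eq_zero]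
    · exact Nat.zero_le _
    · intro p hp
      obtain ⟨x, -, rfl⟩ := Finset.mem_image.1 (Finset.mem_filter.1 hp).1
      rfl

theorem le_self {b : WP n k} (hb : IsWP b) : WP.le b b := by
  refine le_intro hb hb (fun p hp => ⟨p, hp, subset_rfl⟩) ?_
  intro q hq i
  have : b.filter (fun p => p.1 ⊆ q.1) = {q} := by
    ext p
    rw [Finset.mem_filter, Finset.mem_singleton]
    constructor
    · rintro ⟨hp, hs⟩
      by_contra hne
      obtain ⟨x, hx⟩ := hb.1 p hp
      exact Finset.disjoint_left.1 (hb.2.1 p hp q hq hne) hx (hs hx)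
    · rintro rfl; exact ⟨hq, subset_rfl⟩
  rw [this]; simp

theorem card_lt {c b : WP n k} (h : WP.le c b) (hne : c ≠ b) : b.card < c.card := by
  obtain ⟨hc, hb, hr, hs⟩ := h
  by_contra hcard
  rw [not_lt] at hcard
  have hU : c = b.biUnion fun q => c.filter fun p => p.1 ⊆ q.1 := by
    ext p
    simp only [Finset.mem_biUnion, Finset.mem_filter]
    constructor
    · intro hp
      obtain ⟨q, hq, h⟩ := hr p hp
      exact ⟨q, hq, hp, h⟩
    · rintro ⟨q, -, hp, -⟩; exact hp
  have hcU : c.card = ∑ q ∈ b, (c.filter fun p => p.1 ⊆ q.1).card := by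
    conv_lhs => rw [hU]
    rw [Finset.card_biUnion]
    intro q hq q' hq' hqq
    rw [Function.onFun, Finset.disjoint_left]
    intro p hp hp'
    rw [Finset.mem_filter] at hp hp'
    obtain ⟨x, hx⟩ := hc.1 p hp.1
    exact Finset.disjoint_left.1 (hb.2.1 q hq q' hq' hqq) (hp.2 hx) (hp'.2 hx)
  have hpos : ∀ q ∈ b, 1 ≤ (c.filter fun p => p.1 ⊆ q.1).card := fun q hq =>
    card_pos_of_part (part_filter hc hb hr hq) (hb.1 q hq)
  have hle : b.card ≤ c.card := by
    rw [hcU, Finset.card_eq_sum_ones]; exact Finset.sum_le_sum hpos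
  have hall : ∀ q ∈ b, 1 = (c.filter fun p => p.1 ⊆ q.1).card := by
    rw [← Finset.sum_eq_sum_iff_of_le hpos, ← hcU, ← Finset.card_eq_sum_ones]; omega
  have hsub : b ⊆ c := by
    intro q hq
    obtain ⟨p, hp⟩ := Finset.card_eq_one.1 (hall q hq).symm
    have hpart := part_filter hc hb hr hq
    have hss := (hs q hq).1
    rw [hp] at hpart hss
    have hpc : p ∈ c := (Finset.mem_filter.1 (hp ▸ Finset.mem_singleton_self p :
      p ∈ c.filter fun p => p.1 ⊆ q.1)).1
    have e1 : p.1 = q.1 := by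
      ext x; rw [hpart.2.2.1 x]; simp
    have e2 : p.2 = q.2 := by
      simp only [Finset.sum_singleton] at hss
      have := hc.2.2.2 p hpc
      have h2 := hb.2.2.2 q hq
      rw [e1] at this
      have h3 : ∑ i, p.2 i = ∑ i, q.2 i := by
        change wsum p.2 = wsum q.2; omega
      ext i
      exact (Finset.sum_eq_sum_iff_of_le (fun i _ => hss i)).1 h3 i (Finset.mem_univ i)
    rwa [← Prod.ext e1 e2]
  exact hne (Finset.eq_of_subset_of_card_le hsub hcard).symm

theorem exists_big {b : WP n k} (hb : IsWP b) (hne : b ≠ WP.bot n k) : ∃ q ∈ b, 2 ≤ q.1.card := by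
  by_contra! H
  apply hne
  have hq : ∀ q ∈ b, ∃ x, q = ({x}, fun _ => 0) := by
    intro q hq
    have h1 := H q hq
    have h2 := hb.2.2.2 q hq
    obtain ⟨x, hx⟩ := Finset.card_eq_one.1 (show q.1.card = 1 by omega)
    refine ⟨x, Prod.ext hx ?_⟩
    ext i
    have h3 : ∑ i, q.2 i = 0 := by change wsum q.2 = 0; omega
    exact Finset.sum_eq_zero_iff.1 h3 i (Finset.mem_univ i)
  ext p
  rw [WP.bot, Finset.mem_image]
  constructor
  · intro hp
    obtain ⟨x, rfl⟩ := hq p hp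
    exact ⟨x, Finset.mem_univ x, rfl⟩
  · rintro ⟨x, -, rfl⟩
    obtain ⟨p, hp, hx⟩ := hb.2.2.1 x
    obtain ⟨y, rfl⟩ := hq p hp
    have : x = y := by simpa using hx
    subst this
    exact hp

noncomputable def nuP (c : WP n k) : ℚ := ∏ p ∈ c, nu p.2

open Classical in
noncomputable def Low (b : WP n k) : Finset (WP n k) := (Parts k Finset.univ).filter fun c => WP.le c b

theorem mem_Low {b c : WP n k} : c ∈ Low b ↔ WP.le c b := by
  classical
  rw [Low, Finset.mem_filter, mem_Parts, isPart_univ]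
  exact ⟨fun h => h.2, fun h => ⟨h.1, h⟩⟩

theorem replace_le {c b d : WP n k} (h : WP.le c b) {q} (hq : q ∈ b) (hd : IsPart q.1 d)
    (hds : ∀ i, ∑ p ∈ d, p.2 i ≤ q.2 i) :
    WP.le ((c.filter fun p => ¬ p.1 ⊆ q.1) ∪ d) b := by
  obtain ⟨hc, hb, hr, hs⟩ := h
  have hd1 : ∀ p ∈ d, p.1 ⊆ q.1 := fun p hp x hx => (hd.2.2.1 x).2 ⟨p, hp, hx⟩
  have he : ∀ p ∈ c, ¬ p.1 ⊆ q.1 → Disjoint p.1 q.1 := by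
    intro p hp hn
    obtain ⟨q', hq', hpq⟩ := hr p hp
    have : q' ≠ q := by rintro rfl; exact hn hpq
    exact (hb.2.1 q' hq' q hq this).mono_left hpq
  refine le_intro ⟨?_, ?_, ?_, ?_⟩ hb ?_ ?_
  · intro p hp
    rcases Finset.mem_union.1 hp with hp | hp
    · exact hc.1 p (Finset.mem_filter.1 hp).1
    · exact hd.1 p hp
  · intro p hp r hr hpr
    rcases Finset.mem_union.1 hp with hp | hp <;> rcases Finset.mem_union.1 hr with hr | hr
    · exact hc.2.1 p (Finset.mem_filter.1 hp).1 r (Finset.mem_filter.1 hr).1 hpr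
    · rw [Finset.mem_filter] at hp
      exact (he p hp.1 hp.2).mono_right (hd1 r hr)
    · rw [Finset.mem_filter] at hr
      exact ((he r hr.1 hr.2).mono_right (hd1 p hp)).symm
    · exact hd.2.1 p hp r hr hpr
  · intro x
    by_cases hx : x ∈ q.1
    · obtain ⟨p, hp, hxp⟩ := (hd.2.2.1 x).1 hx
      exact ⟨p, Finset.mem_union_right _ hp, hxp⟩
    · obtain ⟨p, hp, hxp⟩ := hc.2.2.1 x
      exact ⟨p, Finset.mem_union_left _ (Finset.mem_filter.2 ⟨hp, fun h => hx (h hxp)⟩), hxp⟩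
  · intro p hp
    rcases Finset.mem_union.1 hp with hp | hp
    · exact hc.2.2.2 p (Finset.mem_filter.1 hp).1
    · exact hd.2.2.2 p hp
  · intro p hp
    rcases Finset.mem_union.1 hp with hp | hp
    · exact hr p (Finset.mem_filter.1 hp).1
    · exact ⟨q, hq, hd1 p hp⟩
  · intro r hrb i
    by_cases hrq : r = q
    · subst hrq
      have : ((c.filter fun p => ¬ p.1 ⊆ r.1) ∪ d).filter (fun p => p.1 ⊆ r.1) = d := by
        ext p
        simp only [Finset.mem_filter, Finset.mem_union]
        have := hd1 p
        tauto
      rw [this]; exact hds i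
    · have hdis := hb.2.1 r hrb q hq hrq
      have : ((c.filter fun p => ¬ p.1 ⊆ q.1) ∪ d).filter (fun p => p.1 ⊆ r.1) =
          c.filter (fun p => p.1 ⊆ r.1) := by
        ext p
        simp only [Finset.mem_filter, Finset.mem_union]
        have key : p.1.Nonempty → p.1 ⊆ r.1 → ¬ p.1 ⊆ q.1 := by
          rintro ⟨x, hx⟩ h1 h2
          exact Finset.disjoint_left.1 hdis (h1 hx) (h2 hx)
        have := hd1 p
        have := hd.1 p
        have := hc.1 p
        tauto
      rw [this]; exact (hs r hrb).1 i

theorem split_filter (c : WP n k) (q : Finset (Fin n) × (Fin k → ℕ)) :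
    (c.filter fun p => ¬ p.1 ⊆ q.1) ∪ (c.filter fun p => p.1 ⊆ q.1) = c := by
  ext p
  by_cases h : p.1 ⊆ q.1 <;> simp [h]

theorem rest_union (c d : WP n k) (q : Finset (Fin n) × (Fin k → ℕ)) (hd : ∀ p ∈ d, p.1 ⊆ q.1) :
    (((c.filter fun p => ¬ p.1 ⊆ q.1) ∪ d).filter fun p => ¬ p.1 ⊆ q.1) =
      c.filter fun p => ¬ p.1 ⊆ q.1 := by
  ext p
  have := hd p
  simp only [Finset.mem_filter, Finset.mem_union]
  tauto

theorem sum_Low {b : WP n k} (hb : IsWP b) (hne : b ≠ WP.bot n k) : ∑ c ∈ Low b, nuP c = 0 := by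
  classical
  obtain ⟨q, hq, hq2⟩ := exists_big hb hne
  rw [← Finset.sum_fiberwise_of_maps_to (s := Low b)
    (t := (Low b).image fun c => c.filter fun p => ¬ p.1 ⊆ q.1)
    (g := fun c => c.filter fun p => ¬ p.1 ⊆ q.1) (fun c hc => Finset.mem_image_of_mem _ hc)]
  refine Finset.sum_eq_zero fun e he => ?_
  obtain ⟨c0, hc0, rfl⟩ := Finset.mem_image.1 he
  rw [mem_Low] at hc0
  set e := c0.filter fun p => ¬ p.1 ⊆ q.1 with hedef
  have hv := vanish (k := k) q.1 hq2 q.2 (hb.2.2.2 q hq)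
  have : ∑ d ∈ (Parts k q.1).filter (fun c => ∀ i, ∑ p ∈ c, p.2 i ≤ q.2 i), nuP (e ∪ d) =
      ∑ c ∈ (Low b).filter (fun c => (c.filter fun p => ¬ p.1 ⊆ q.1) = e), nuP c := by
    have hdd : ∀ d ∈ (Parts k q.1).filter (fun c => ∀ i, ∑ p ∈ c, p.2 i ≤ q.2 i),
        ∀ p ∈ d, p.1 ⊆ q.1 := by
      intro d hd p hp x hx
      exact ((mem_Parts.1 (Finset.mem_filter.1 hd).1).2.2.1 x).2 ⟨p, hp, hx⟩
    refine Finset.sum_bij (fun d _ => e ∪ d) ?_ ?_ ?_ ?_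
    · intro d hd
      have hd1 := hdd d hd
      rw [Finset.mem_filter, mem_Parts] at hd
      rw [Finset.mem_filter, mem_Low]
      refine ⟨replace_le hc0 hq hd.1 hd.2, ?_⟩
      exact rest_union c0 d q hd1
    · intro d hd d' hd' heq
      have aux : ∀ u v : WP n k, (∀ p ∈ u, p.1 ⊆ q.1) → e ∪ u = e ∪ v → u ⊆ v := by
        intro u v hu h p hp
        have h3 : p ∈ e ∪ v := h ▸ Finset.mem_union_right e hp
        rcases Finset.mem_union.1 h3 with h4 | h4
        · exact absurd (hu p hp) (Finset.mem_filter.1 h4).2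
        · exact h4
      exact (aux d d' (hdd d hd) heq).antisymm (aux d' d (hdd d' hd') heq.symm)
    · intro c hc
      rw [Finset.mem_filter, mem_Low] at hc
      obtain ⟨⟨hcw, -, hr, hs⟩, hce⟩ := hc
      refine ⟨c.filter fun p => p.1 ⊆ q.1, ?_, ?_⟩
      · rw [Finset.mem_filter, mem_Parts]
        exact ⟨part_filter hcw hb hr hq, (hs q hq).1⟩
      · rw [← hce]
        exact split_filter c q
    · intros; rfl
  rw [← this]
  have h2 : ∀ d ∈ (Parts k q.1).filter (fun c => ∀ i, ∑ p ∈ c, p.2 i ≤ q.2 i),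
      nuP (e ∪ d) = nuP e * ∏ p ∈ d, nu p.2 := by
    intro d hd
    rw [nuP, Finset.prod_union, nuP]
    rw [Finset.disjoint_left]
    intro p hp hpd
    refine (Finset.mem_filter.1 hp).2 fun x hx => ?_
    exact ((mem_Parts.1 (Finset.mem_filter.1 hd).1).2.2.1 x).2 ⟨p, hpd, hx⟩
  rw [Finset.sum_congr rfl h2, ← Finset.mul_sum, hv, mul_zero]

theorem nuP_bot : nuP (WP.bot n k) = 1 := by
  refine Finset.prod_eq_one fun p hp => ?_
  obtain ⟨x, -, rfl⟩ := Finset.mem_image.1 hp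
  exact nu_zero

theorem card_bot : (WP.bot n k).card = n := by
  rw [WP.bot, Finset.card_image_of_injective]
  · simp
  · intro x y h; simpa using h

theorem mobius_nuP (m : ℕ) : ∀ b : WP n k, IsWP b → n - b.card ≤ m →
    ((mobiusAux WP.le m (WP.bot n k) b : ℤ) : ℚ) = nuP b := by
  classical
  induction m with
  | zero =>
    intro b hb hm
    have : WP.bot n k = b := by
      by_contra hne
      have := card_lt (bot_le hb) hne
      rw [card_bot] at this; omega
    rw [mobiusAux, if_pos this, ← this, nuP_bot]; simp
  | succ m ih =>
    intro b hb hm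
    rw [mobiusAux]
    split_ifs with h
    · rw [← h, nuP_bot]; simp
    · have hset : {c | WP.le (WP.bot n k) c ∧ WP.le c b ∧ c ≠ b} =
          (((Low b).erase b : Finset (WP n k)) : Set (WP n k)) := by
        ext c
        simp only [Set.mem_ofPred_eq, Finset.mem_coe, Finset.mem_erase, mem_Low]
        constructor
        · exact fun h => ⟨h.2.2, h.2.1⟩
        · exact fun h => ⟨bot_le h.2.1, h.2, h.1⟩
      rw [hset, finsum_mem_coe_finset]
      have hs := sum_Low hb (Ne.symm h)
      rw [← Finset.add_sum_erase _ _ (mem_Low.2 (le_self hb))] at hs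
      push_cast
      rw [Finset.sum_congr rfl fun c hc => ?_]
      · exact (eq_neg_of_add_eq_zero_left hs).symm
      · rw [Finset.mem_erase, mem_Low] at hc
        have := card_lt hc.2 hc.1
        exact ih c hc.2.1 (by omega)

theorem isWP_top (hn : 1 ≤ n) (f : Fin k → ℕ) (hf : (∑ i, f i) = n - 1) : IsWP (WP.top n k f) := by
  have : NeZero n := ⟨by omega⟩
  refine ⟨?_, ?_, ?_, ?_⟩
  · intro p hp
    rw [WP.top, Finset.mem_singleton] at hp
    subst hp
    exact ⟨0, Finset.mem_univ _⟩
  · intro p hp q hq hpq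
    rw [WP.top, Finset.mem_singleton] at hp hq
    exact absurd (hp.trans hq.symm) hpq
  · intro x
    exact ⟨_, Finset.mem_singleton_self _, Finset.mem_univ _⟩
  · intro p hp
    rw [WP.top, Finset.mem_singleton] at hp
    subst hp
    simp [wsum, hf]; omega

theorem mobius_top (hn : 1 ≤ n) (f : Fin k → ℕ) (hf : (∑ i, f i) = n - 1) :
    WP.mobius (WP.bot n k) (WP.top n k f) =
      (-1 : ℤ) ^ (n - 1) * Nat.card (Tset k AAok (Finset.Icc 1 (n-1)) (Finsupp.equivFunOnFinite.symm f)) := by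
  have h := mobius_nuP n (WP.top n k f) (isWP_top hn f hf) (by omega)
  have h2 := coeff_d (k := k) (Finset.Icc 1 (n-1)) (Finsupp.equivFunOnFinite.symm f)
  have h3 : nuP (WP.top n k f) = (-1) ^ (n-1) *
      (Nat.card (Tset k AAok (Finset.Icc 1 (n-1)) (Finsupp.equivFunOnFinite.symm f)) : ℚ) := by
    rw [← h2, nuP, WP.top, Finset.prod_singleton, nu, coeff_ds]
    simp [wsum, hf, fs]
  rw [h3] at h
  have : ((WP.mobius (WP.bot n k) (WP.top n k f) : ℤ) : ℚ) = (((-1 : ℤ) ^ (n - 1) *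
      Nat.card (Tset k AAok (Finset.Icc 1 (n-1)) (Finsupp.equivFunOnFinite.symm f)) : ℤ) : ℚ) := by
    rw [WP.mobius, h]; push_cast; rfl
  exact_mod_cast this

end SP

/-- For all `n, k ≥ 1` and `μ ∈ wcomp_{n-1}` with `supp(μ) ⊆ [k]` (given as
`f : Fin k → ℕ` with `Σ f = n-1`), the Möbius function of the maximal interval
`[0̂,[n]^μ]` of `Π_n^k` equals `(-1)^{n-1} |Q^{AA}_μ| = (-1)^{n-1} |Q^{TN}_μ|`. -/
theorem mobius_eq_signed_card_coloredStirling
    (n k : ℕ) (hn : 1 ≤ n) (hk : 1 ≤ k) (f : Fin k → ℕ) (hf : (∑ i, f i) = n - 1) :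
    WP.mobius (WP.bot n k) (WP.top n k f) =
        (-1 : ℤ) ^ (n - 1) * Nat.card (QAAset n k f) ∧
      WP.mobius (WP.bot n k) (WP.top n k f) =
        (-1 : ℤ) ^ (n - 1) * Nat.card (QTNset n k f) := by
  have h := SP.mobius_top hn f hf
  refine ⟨?_, ?_⟩
  · rw [h, SP.T.card_AA]
  · rw [h, SP.T.card_TN, SP.T.card_rot]
end

section
/- For every finite set A of positive integers, the map ξ: Q_A → Q_A is a well-defined bijection and satisfies: (1) (i,j) is an ascending adjacent pair of θ if and only if (i,j) is a terminally nested pair of ξ(θ); (2) λ^{TN}(ξ(θ)) = λ^{AA}(θ) for all θ ∈ Q_A. -/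
namespace XiProof

inductive STree : Type
  | nil : STree
  | node : ℕ → STree → STree → STree

open STree

def word : STree → List ℕ
  | nil => []
  | node a s r => a :: (word s ++ a :: word r)

def labels : STree → List ℕ
  | nil => []
  | node a s r => a :: (labels s ++ labels r)

def app : STree → STree → STree
  | nil, u => u
  | node a s r, u => node a s (app r u)

def inc : STree → Prop
  | nil => True
  | node a s r => inc s ∧ inc r ∧ ∀ x ∈ labels s, a < x

def glue (a : ℕ) (s : STree) : STree → STree
  | nil => node a nil s
  | node b x y => if b < a then node a nil (app s (node b x y))
      else node a (app s (node b x nil)) y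

def xi : STree → STree
  | nil => nil
  | node a s r => glue a (xi s) (xi r)

def headO : STree → Option ℕ
  | nil => none
  | node a _ _ => some a

def lastO : STree → Option ℕ
  | nil => none
  | node a _ nil => some a
  | node _ _ (node b s r) => lastO (node b s r)

def AAt : STree → ℕ → ℕ → Prop
  | nil, _, _ => False
  | node a s r, i, j => (i = a ∧ headO r = some j ∧ i < j) ∨ AAt s i j ∨ AAt r i j

def TNt : STree → ℕ → ℕ → Prop
  | nil, _, _ => False
  | node a s r, i, j => (i = a ∧ lastO s = some j ∧ i < j) ∨ TNt s i j ∨ TNt r i j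

theorem app_nil (t : STree) : app t nil = t := by
  induction t with
  | nil => rfl
  | node a s r _ ih => simp [app, ih]

theorem app_assoc (s t u : STree) : app (app s t) u = app s (app t u) := by
  induction s with
  | nil => rfl
  | node a s r _ ih => simp [app, ih]

theorem labels_app (s t : STree) : labels (app s t) = labels s ++ labels t := by
  induction s with
  | nil => rfl
  | node a s r _ ih => simp [app, labels, ih]

theorem word_app (s t : STree) : word (app s t) = word s ++ word t := by
  induction s with
  | nil => rfl
  | node a s r _ ih => simp [app, word, ih]

theorem inc_app (s t : STree) : inc (app s t) ↔ inc s ∧ inc t := by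
  induction s with
  | nil => simp [app, inc]
  | node a s r _ ih => simp [app, inc, ih]; tauto

theorem TNt_app (s t : STree) (i j : ℕ) : TNt (app s t) i j ↔ TNt s i j ∨ TNt t i j := by
  induction s with
  | nil => simp [app, TNt]
  | node a s r _ ih => simp [app, TNt, ih]; tauto

theorem lastO_app (s : STree) (b : ℕ) (x : STree) : lastO (app s (node b x nil)) = some b := by
  induction s with
  | nil => simp [app, lastO]
  | node a s r _ ih =>
    cases r with
    | nil => simp [app, lastO]
    | node c u v => simpa [app, lastO] using ih

theorem lastO_node (a : ℕ) (s r : STree) :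
    lastO (node a s r) = (lastO r).or (some a) := by
  induction r generalizing a s with
  | nil => simp [lastO]
  | node b u v _ ih => rw [lastO, ih]; simp

theorem mem_word (t : STree) (x : ℕ) : x ∈ word t ↔ x ∈ labels t := by
  induction t with
  | nil => simp [word, labels]
  | node a s r ih1 ih2 => simp [word, labels, ih1, ih2]; tauto

theorem labels_xi (t : STree) : (labels (xi t)).Perm (labels t) := by
  induction t with
  | nil => simp [xi, labels]
  | node a s r ih1 ih2 =>
    simp only [xi, labels]
    refine List.Perm.trans ?_ (List.Perm.cons a (ih1.append ih2))
    cases h : xi r with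
    | nil => simp [glue, labels]
    | node b x y =>
      simp only [glue]
      split_ifs <;> simp [labels, labels_app]

theorem inc_xi (t : STree) (h : inc t) (hn : (labels t).Nodup) : inc (xi t) := by
  induction t with
  | nil => simp [xi, inc]
  | node a s r ih1 ih2 =>
    obtain ⟨h1, h2, h3⟩ := h
    simp only [labels, List.nodup_cons, List.nodup_append, List.mem_append] at hn
    have k1 := ih1 h1 hn.2.1
    have k2 := ih2 h2 hn.2.2.1
    have k3 : ∀ x ∈ labels (xi s), a < x := fun x hx => h3 x ((labels_xi s).mem_iff.1 hx)
    have k4 : a ∉ labels (xi r) := fun hx => hn.1 (Or.inr ((labels_xi r).mem_iff.1 hx))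
    simp only [xi]
    cases h : xi r with
    | nil => simp [glue, inc, k1, labels]
    | node b x y =>
      rw [h] at k2 k4
      simp only [inc, labels, List.mem_cons, List.mem_append, not_or] at k2 k4
      simp only [glue]
      split_ifs with hb
      · simp [inc, inc_app, labels, k1, k2]
        exact k2.2.2
      · simp only [inc, inc_app, labels_app, labels, k1, k2, List.mem_append, List.mem_cons]
        have : a < b := by omega
        refine ⟨⟨trivial, trivial, trivial, k2.2.2⟩, trivial, ?_⟩
        rintro x (hx | hx | hx | hx)
        · exact k3 x hx
        · omega
        · have := k2.2.2 x hx; omega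
        · simp at hx

theorem head_xi (t : STree) : headO (xi t) = headO t := by
  cases t with
  | nil => rfl
  | node a s r =>
    simp only [xi]
    cases h : xi r with
    | nil => simp [glue, headO]
    | node b x y => simp only [glue]; split_ifs <;> simp [headO]

theorem AA_TN (t : STree) (h : inc t) (hn : (labels t).Nodup) (i j : ℕ) :
    AAt t i j ↔ TNt (xi t) i j := by
  induction t with
  | nil => simp [xi, AAt, TNt]
  | node a s r ih1 ih2 =>
    obtain ⟨h1, h2, h3⟩ := h
    simp only [labels, List.nodup_cons, List.nodup_append, List.mem_append] at hn
    have k1 := ih1 h1 hn.2.1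
    have k2 := ih2 h2 hn.2.2.1
    have k4 : a ∉ labels (xi r) := fun hx => hn.1 (Or.inr ((labels_xi r).mem_iff.1 hx))
    simp only [AAt, xi, k1, k2, ← head_xi r]
    cases h : xi r with
    | nil => simp [glue, TNt, headO, lastO]
    | node b x y =>
      rw [h] at k4
      simp only [labels, List.mem_cons, List.mem_append, not_or] at k4
      simp only [glue]
      split_ifs with hb
      · simp only [TNt, TNt_app, headO, lastO]
        constructor
        · rintro (⟨rfl, h1, h2⟩ | h)
          · simp at h1; omega
          · exact Or.inr (Or.inr h)
        · rintro (⟨rfl, h1, h2⟩ | h)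
          · simp at h1
          · exact Or.inr (h.resolve_left id)
      · simp only [TNt, TNt_app, headO, lastO_app, or_false, or_assoc]

theorem app_cancel (a : ℕ) (s s' u u' : STree) (hs : ∀ x ∈ labels s, a < x)
    (hs' : ∀ x ∈ labels s', a < x) (hu : ∀ x, headO u = some x → x < a)
    (hu' : ∀ x, headO u' = some x → x < a) (h : app s u = app s' u') : s = s' ∧ u = u' := by
  induction s generalizing s' with
  | nil =>
    cases s' with
    | nil => exact ⟨rfl, h⟩
    | node b x y =>
      simp only [app] at h
      subst h
      have := hu b rfl
      have := hs' b (by simp [labels])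
      omega
  | node c p q _ ih =>
    cases s' with
    | nil =>
      simp only [app] at h
      subst h
      have := hu' c rfl
      have := hs c (by simp [labels])
      omega
    | node b x y =>
      simp only [app, node.injEq] at h
      obtain ⟨rfl, rfl, h⟩ := h
      obtain ⟨rfl, rfl⟩ := ih y (fun z hz => hs z (by simp [labels, hz]))
        (fun z hz => hs' z (by simp [labels, hz])) h
      exact ⟨rfl, rfl⟩

theorem app_last_ne (s : STree) (b : ℕ) (x : STree) : app s (node b x nil) ≠ nil := by
  cases s <;> simp [app]

theorem app_last_cancel (s s' : STree) (b b' : ℕ) (x x' : STree)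
    (h : app s (node b x nil) = app s' (node b' x' nil)) : s = s' ∧ b = b' ∧ x = x' := by
  induction s generalizing s' with
  | nil =>
    cases s' with
    | nil => simpa [app] using h
    | node c p q =>
      simp only [app, node.injEq] at h
      exact absurd h.2.2.symm (app_last_ne _ _ _)
  | node c p q _ ih =>
    cases s' with
    | nil =>
      simp only [app, node.injEq] at h
      exact absurd h.2.2 (app_last_ne _ _ _)
    | node d u y =>
      simp only [app, node.injEq] at h
      obtain ⟨rfl, rfl, h⟩ := h
      obtain ⟨rfl, h'⟩ := ih y h
      exact ⟨rfl, h'⟩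

/-- normal form of `glue` -/
theorem glue_cases (a : ℕ) (s u : STree) (ha : a ∉ labels u) :
    ((∀ x, headO u = some x → x < a) ∧ glue a s u = node a nil (app s u)) ∨
    (∃ b x y, u = node b x y ∧ a < b ∧ glue a s u = node a (app s (node b x nil)) y) := by
  cases u with
  | nil => left; simp [headO, glue, app_nil]
  | node b x y =>
    simp only [labels, List.mem_cons, not_or] at ha
    by_cases hb : b < a
    · left; simp [headO, glue, hb]
    · right; exact ⟨b, x, y, rfl, by omega, by simp [glue, hb]⟩

theorem xi_inj (t t' : STree) (h : inc t) (hn : (labels t).Nodup) (h' : inc t')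
    (hn' : (labels t').Nodup) (he : xi t = xi t') : t = t' := by
  induction t generalizing t' with
  | nil =>
    have := head_xi t'
    rw [← he] at this
    cases t' with
    | nil => rfl
    | node _ _ _ => simp [xi, headO] at this
  | node a s r ih1 ih2 =>
    cases t' with
    | nil =>
      have := head_xi (node a s r)
      rw [he] at this
      simp [xi, headO] at this
    | node a' s' r' =>
      have e : a = a' := by
        have k := head_xi (node a s r)
        rw [he, head_xi] at k
        simpa [headO] using k.symm
      subst e
      obtain ⟨h1, h2, h3⟩ := h
      obtain ⟨h1', h2', h3'⟩ := h'
      simp only [labels, List.nodup_cons, List.nodup_append, List.mem_append] at hn hn'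
      have k3 : ∀ x ∈ labels (xi s), a < x := fun x hx => h3 x ((labels_xi s).mem_iff.1 hx)
      have k4 : a ∉ labels (xi r) := fun hx => hn.1 (Or.inr ((labels_xi r).mem_iff.1 hx))
      have k3' : ∀ x ∈ labels (xi s'), a < x := fun x hx => h3' x ((labels_xi s').mem_iff.1 hx)
      have k4' : a ∉ labels (xi r') := fun hx => hn'.1 (Or.inr ((labels_xi r').mem_iff.1 hx))
      have key : xi s = xi s' ∧ xi r = xi r' := by
        simp only [xi] at he
        rcases glue_cases a (xi s) (xi r) k4 with ⟨hd, g⟩ | ⟨b, x, y, hd, hb, g⟩ <;>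
        rcases glue_cases a (xi s') (xi r') k4' with ⟨hd', g'⟩ | ⟨b', x', y', hd', hb', g'⟩ <;>
        rw [g, g'] at he <;> simp only [node.injEq, true_and] at he
        · exact app_cancel a _ _ _ _ k3 k3' hd hd' he
        · exact absurd he.1.symm (app_last_ne _ _ _)
        · exact absurd he.1 (app_last_ne _ _ _)
        · obtain ⟨e1, rfl, rfl⟩ := app_last_cancel _ _ _ _ _ _ he.1
          rw [hd, hd', he.2]
          exact ⟨e1, rfl⟩
      rw [ih1 s' h1 hn.2.1 h1' hn'.2.1 key.1, ih2 r' h2 hn.2.2.1 h2' hn'.2.2.1 key.2]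

theorem notMem_word {a : ℕ} {s : STree} (h : ∀ x ∈ labels s, a < x) : a ∉ word s := by
  rw [mem_word]
  intro hx
  exact lt_irrefl _ (h a hx)

theorem word_inj (t t' : STree) (h : inc t) (h' : inc t') (he : word t = word t') : t = t' := by
  induction t generalizing t' with
  | nil => cases t' with
    | nil => rfl
    | node _ _ _ => simp [word] at he
  | node a s r ih1 ih2 => cases t' with
    | nil => simp [word] at he
    | node a' s' r' =>
      obtain ⟨h1, h2, h3⟩ := h
      obtain ⟨h1', h2', h3'⟩ := h'
      simp only [word, List.cons.injEq] at he
      obtain ⟨rfl, he⟩ := he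
      have n1 := notMem_word h3
      have n2 := notMem_word h3'
      have : word s = word s' ∧ word r = word r' := by
        rw [List.append_eq_append_iff] at he
        rcases he with ⟨l, e1, e2⟩ | ⟨l, e1, e2⟩ <;> cases l <;> simp_all
      rw [ih1 s' h1 h1' this.1, ih2 r' h2 h2' this.2]

/-! the recursive definition agrees with `xiMap` -/

def blocks : STree → List (List ℕ)
  | nil => []
  | node a s r => (a :: (word s ++ [a])) :: blocks r

theorem blocks_flatten (t : STree) : (blocks t).flatten = word t := by
  induction t with
  | nil => rfl
  | node a s r _ ih => simp [blocks, word, ih]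

theorem toBlocksAux_word (t : STree) (h : inc t) (f : ℕ) (hf : (word t).length ≤ f) :
    toBlocksAux f (word t) = blocks t := by
  induction t generalizing f with
  | nil => cases f <;> rfl
  | node a s r _ ih =>
    obtain ⟨h1, h2, h3⟩ := h
    have n1 := notMem_word h3
    cases f with
    | zero => simp [word] at hf
    | succ f =>
      have e : (word s ++ a :: word r).findIdx (· = a) = (word s).length := by
        rw [List.findIdx_append]
        have : List.findIdx (fun x => decide (x = a)) (word s) = (word s).length := by
          rw [List.findIdx_eq_length]
          intro x hx
          simp only [decide_eq_false_iff_not]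
          rintro rfl; exact n1 hx
        rw [this]; simp [List.findIdx_cons]
      have e2 : blockSplit (a :: (word s ++ a :: word r)) = (a :: (word s ++ [a]), word r) := by
        simp only [blockSplit, e]
        have e3 : word s ++ a :: word r = (word s ++ [a]) ++ word r := by simp
        have e4 : (word s).length + 1 = (word s ++ [a]).length := by simp
        rw [e3, e4, List.take_left, List.drop_left]
      simp only [word, toBlocksAux, e2, blocks]
      rw [ih h2]
      simp [word] at hf
      omega

theorem split_eq (a c : ℕ) (s u v : STree) :
    splitAtDescent (blocks (node a s (node c u v))) =
      if c < a then some (blocks (node a s nil), blocks (node c u v))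
      else (splitAtDescent (blocks (node c u v))).map
        fun p => ((a :: (word s ++ [a])) :: p.1, p.2) := rfl

theorem split_none_aux (t : STree) (f : ℕ) (a : ℕ) (s : STree)
    (hs : splitAtDescent (blocks (node a s t)) = none)
    (hx : ∀ u, inc u → (word u).length < (word (node a s t)).length →
      xiAux f (word u) = word (xi u)) (hi : inc (node a s t)) :
    ∃ X Y, xi (node a s t) = node a X Y ∧
    (List.zipWith (fun a τ => a :: xiAux f τ)
        (a :: (blocks t).map fun b => b.headD 0).dropLast
        (word s :: (blocks t).map fun b => b.tail.dropLast).dropLast).flatten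
          ++ ((a :: (blocks t).map fun b => b.headD 0).getLastD 0 ::
            ((blocks t).map fun b => b.headD 0).reverse) = a :: word X ∧
      xiAux f ((word s :: (blocks t).map fun b => b.tail.dropLast).getLastD []) = word Y := by
  induction t generalizing a s with
  | nil =>
    refine ⟨nil, xi s, by simp [xi, glue], by simp [blocks, word], ?_⟩
    simpa [blocks] using hx s hi.1 (by simp [word])
  | node c u v _ ih =>
    have hs1 : ¬ c < a ∧ splitAtDescent (blocks (node c u v)) = none := by
      rw [split_eq] at hs
      split_ifs at hs with hc
      exact ⟨hc, by simpa using hs⟩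
    obtain ⟨X, Y, e1, e2, e3⟩ :=
      ih c u hs1.2 (fun w hw hl => hx w hw (by simp [word] at hl ⊢; omega)) hi.2.1
    have es := hx s hi.1 (by simp [word])
    refine ⟨app (xi s) (node c X nil), Y, ?_, ?_, ?_⟩
    · rw [xi, e1]; simp [glue, hs1.1]
    · simp only [blocks, List.map_cons, List.headD_cons, List.tail_cons,
        List.dropLast_concat, List.reverse_cons, List.dropLast_cons_cons, List.zipWith_cons_cons,
        List.flatten_cons, es, word_app, word]
      have e4 : ∀ l : List ℕ, (a :: c :: l).getLastD 0 = (c :: l).getLastD 0 := by intro l; simp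
      rw [e4]
      have := congrArg (fun l => a :: word (xi s) ++ (l ++ [c])) e2
      simpa using this
    · rw [← e3]
      simp [blocks]

theorem split_none (t : STree) (f : ℕ) (a : ℕ) (s : STree)
    (hs : splitAtDescent (blocks (node a s t)) = none)
    (hx : ∀ u, inc u → (word u).length < (word (node a s t)).length →
      xiAux f (word u) = word (xi u)) (hi : inc (node a s t)) :
    (List.zipWith (fun a τ => a :: xiAux f τ)
        ((blocks (node a s t)).map fun b => b.headD 0).dropLast
        ((blocks (node a s t)).map fun b => (b.drop 1).dropLast).dropLast).flatten
          ++ (((blocks (node a s t)).map fun b => b.headD 0).getLastD 0 ::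
            ((blocks (node a s t)).map fun b => b.headD 0).reverse)
          ++ xiAux f (((blocks (node a s t)).map fun b => (b.drop 1).dropLast).getLastD [])
      = word (xi (node a s t)) := by
  obtain ⟨X, Y, e1, e2, e3⟩ := split_none_aux t f a s hs hx hi
  rw [e1]
  simp only [blocks, List.map_cons, List.headD_cons, List.drop_one, List.tail_cons,
        List.dropLast_concat, List.reverse_cons, e3, word]
  have := congrArg (fun l => l ++ a :: word Y) e2
  simpa using this

theorem split_some (t : STree) (p : List (List ℕ) × List (List ℕ))
    (h : splitAtDescent (blocks t) = some p) :
    ∃ t1 t2, t = app t1 t2 ∧ p = (blocks t1, blocks t2) ∧ t1 ≠ nil ∧ t2 ≠ nil ∧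
      xi t = app (xi t1) (xi t2) := by
  induction t generalizing p with
  | nil => simp [blocks, splitAtDescent] at h
  | node a s r _ ih =>
    cases r with
    | nil => simp [blocks, splitAtDescent] at h
    | node c u v =>
      have hd := head_xi (node c u v)
      rw [split_eq] at h
      split_ifs at h with hc
      · refine ⟨node a s nil, node c u v, rfl, ?_, by simp, by simp, ?_⟩
        · simpa [blocks] using h.symm
        · rw [xi]
          cases hr : xi (node c u v) with
          | nil => rw [hr] at hd; simp [headO] at hd
          | node d x y =>
            rw [hr] at hd
            simp only [headO, Option.some.injEq] at hd
            subst hd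
            simp [glue, hc, xi, app]
      · simp only [Option.map_eq_some_iff] at h
        obtain ⟨q, hq, rfl⟩ := h
        obtain ⟨t1, t2, e1, rfl, n1, n2, e2⟩ := ih q hq
        refine ⟨node a s t1, t2, by simp [app, e1], by simp [blocks], by simp, n2, ?_⟩
        rw [xi, e2, xi]
        have hd1 := head_xi t1
        cases t1 with
        | nil => simp at n1
        | node e m n =>
          cases hr : xi (node e m n) with
          | nil => rw [hr] at hd1; simp [headO] at hd1
          | node d x y =>
            simp only [app, glue]
            split_ifs <;> simp [app, app_assoc]

theorem word_pos {t : STree} (h : t ≠ nil) : 0 < (word t).length := by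
  cases t with
  | nil => simp at h
  | node a s r => simp [word]

theorem xiAux_word (f : ℕ) (t : STree) (h : inc t) (hf : (word t).length ≤ f) :
    xiAux f (word t) = word (xi t) := by
  induction f generalizing t with
  | zero =>
    cases t with
    | nil => rfl
    | node a s r => simp [word] at hf
  | succ f ih =>
    simp only [xiAux, toBlocks, toBlocksAux_word t h _ le_rfl]
    cases hs : splitAtDescent (blocks t) with
    | some p =>
      obtain ⟨t1, t2, rfl, rfl, n1, n2, e⟩ := split_some t p hs
      have p1 := word_pos n1
      have p2 := word_pos n2
      rw [inc_app] at h
      simp only [word_app, List.length_append] at hf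
      simp only [blocks_flatten, e, word_app]
      rw [ih t1 h.1 (by omega), ih t2 h.2 (by omega)]
    | none =>
      cases t with
      | nil => rfl
      | node a s r =>
        exact split_none r f a s hs (fun u hu hl => ih u hu (by omega)) h

theorem xiMap_word (t : STree) (h : inc t) : xiMap (word t) = word (xi t) :=
  xiAux_word _ t h (by omega)
theorem AA_iff (w : List ℕ) (a b : ℕ) : AApair w a b ↔
    a < b ∧ ∃ u v, w = u ++ a :: b :: v ∧ u.count a = 1 ∧ u.count b = 0 := by
  unfold AApair
  refine and_congr_right fun hab => ?_
  constructor
  · rintro ⟨i, h1, h2, h3, h4⟩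
    obtain ⟨hi, e1⟩ := List.getElem?_eq_some_iff.1 h1
    obtain ⟨hi2, e2⟩ := List.getElem?_eq_some_iff.1 h2
    refine ⟨w.take i, w.drop (i+2), ?_, ?_, ?_⟩
    · rw [← e1, ← e2, List.getElem_cons_drop, List.getElem_cons_drop, List.take_append_drop]
    · rw [List.take_succ_eq_append_getElem hi, e1] at h3
      simpa using h3
    · rw [List.take_succ_eq_append_getElem hi, e1] at h4
      simp at h4
      simpa using h4.1
  · rintro ⟨u, v, rfl, h1, h2⟩
    refine ⟨u.length, by simp, ?_, ?_, ?_⟩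
    · simp [List.getElem?_append_right]
    · simp [List.take_append, h1, List.take_of_length_le]
    · simp [List.take_append, h2, List.take_of_length_le, List.count_cons]; omega

theorem TN_iff (w : List ℕ) (a b : ℕ) : TNpair w a b ↔
    a < b ∧ ∃ u v, w = u ++ b :: a :: v ∧ u.count b = 1 ∧ u.count a = 1 := by
  unfold TNpair
  refine and_congr_right fun hab => ?_
  constructor
  · rintro ⟨i, h1, h2, h3, h4⟩
    obtain ⟨hi, e1⟩ := List.getElem?_eq_some_iff.1 h1
    obtain ⟨hi2, e2⟩ := List.getElem?_eq_some_iff.1 h2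
    refine ⟨w.take i, w.drop (i+2), ?_, ?_, ?_⟩
    · rw [← e1, ← e2, List.getElem_cons_drop, List.getElem_cons_drop, List.take_append_drop]
    · rw [List.take_succ_eq_append_getElem hi, e1] at h3
      simpa using h3
    · rw [List.take_succ_eq_append_getElem hi2, e2, List.take_succ_eq_append_getElem hi, e1] at h4
      simp [List.count_cons, hab.ne'] at h4
      exact h4
  · rintro ⟨u, v, rfl, h1, h2⟩
    refine ⟨u.length, by simp, ?_, ?_, ?_⟩
    · simp [List.getElem?_append_right]
    · simp [List.take_append, h1, List.take_of_length_le]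
    · simp [List.take_append, h2, List.take_of_length_le, List.count_cons, hab.ne']

theorem count_word (t : STree) (hn : (labels t).Nodup) (x : ℕ) :
    (word t).count x = if x ∈ labels t then 2 else 0 := by
  have : (word t).count x = 2 * (labels t).count x := by
    clear hn
    induction t with
    | nil => rfl
    | node a s r ih1 ih2 =>
      simp [word, labels, List.count_cons, ih1, ih2]; split_ifs <;> omega
  rw [this]
  split_ifs with h
  · rw [List.count_eq_one_of_mem hn h]
  · rw [List.count_eq_zero_of_not_mem h]

theorem head_word (t : STree) : (word t).head? = headO t := by
  cases t <;> simp [word, headO]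

theorem last_word (t : STree) : (word t).getLast? = lastO t := by
  induction t with
  | nil => rfl
  | node a s r _ ih =>
    rw [lastO_node, ← ih]
    simp only [word]
    rw [← List.cons_append, List.getLast?_append, List.getLast?_cons]
    cases h : (word r).getLast? <;> simp [h]

theorem AA_list (S R : List ℕ) (a i j : ℕ) (h1 : a ∉ S) (h2 : a ∉ R)
    (h3 : ∀ x ∈ S, x ∉ R) :
    AApair (a :: (S ++ a :: R)) i j ↔
      (i = a ∧ R.head? = some j ∧ i < j) ∨ AApair S i j ∨ AApair R i j := by
  simp only [AA_iff]
  constructor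
  · rintro ⟨hij, u, v, e, ci, cj⟩
    cases u with
    | nil => simp at ci
    | cons b u =>
      simp only [List.cons_append, List.cons.injEq] at e
      obtain ⟨rfl, e⟩ := e
      have hj : a ≠ j := by rintro rfl; simp at cj
      rw [List.append_eq_append_iff] at e
      rcases e with ⟨l, e1, e2⟩ | ⟨l, e1, e2⟩
      · subst e1
        rcases l with _ | ⟨x, l⟩
        · simp only [List.nil_append, List.cons.injEq] at e2
          obtain ⟨rfl, rfl⟩ := e2
          left; simp [hij]
        · simp only [List.cons_append, List.cons.injEq] at e2
          obtain ⟨rfl, rfl⟩ := e2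
          have hS : i ∉ S := fun h => h3 i h (by simp)
          have hi : a ≠ i := by rintro rfl; simp at h2
          right; right
          refine ⟨hij, l, v, rfl, ?_, ?_⟩
          · simpa [List.count_cons, hi, hS, List.count_eq_zero_of_not_mem] using ci
          · simp [List.count_cons, hj] at cj
            simp [cj]
      · subst e1
        rcases l with _ | ⟨x, _ | ⟨y, l⟩⟩
        · simp only [List.nil_append, List.cons.injEq] at e2
          obtain ⟨rfl, rfl⟩ := e2
          left; simp [hij]
        · simp only [List.cons_append, List.nil_append, List.cons.injEq] at e2
          exact absurd e2.2.1.symm hj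
        · simp only [List.cons_append, List.cons.injEq] at e2
          obtain ⟨rfl, rfl, rfl⟩ := e2
          have hi : a ≠ i := by rintro rfl; simp at h1
          right; left
          refine ⟨hij, u, l, rfl, ?_, ?_⟩
          · simpa [List.count_cons, hi] using ci
          · simpa [List.count_cons, hj] using cj
  · rintro (⟨rfl, e, hij⟩ | ⟨hij, u, v, rfl, ci, cj⟩ | ⟨hij, u, v, rfl, ci, cj⟩)
    · cases R with
      | nil => simp at e
      | cons b R =>
        simp only [List.head?_cons, Option.some.injEq] at e
        subst e
        refine ⟨hij, i :: S, R, by simp, by simp [List.count_eq_zero_of_not_mem h1], ?_⟩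
        have : b ∉ S := fun h => h3 b h (by simp)
        simp [List.count_cons, hij.ne, List.count_eq_zero_of_not_mem this]
    · refine ⟨hij, a :: u, v ++ a :: R, by simp, ?_, ?_⟩
      · have hi : a ≠ i := by rintro rfl; simp at h1
        simp [List.count_cons, hi, ci]
      · have hi : a ≠ j := by rintro rfl; simp at h1
        simp [List.count_cons, hi, cj]
    · have hS : i ∉ S := fun h => h3 i h (by simp)
      have hS' : j ∉ S := fun h => h3 j h (by simp)
      have hi : a ≠ i := by rintro rfl; simp at h2
      have hj : a ≠ j := by rintro rfl; simp at h2
      refine ⟨hij, a :: (S ++ a :: u), v, by simp, ?_, ?_⟩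
      · simp [List.count_cons, hi, ci, hS, List.count_eq_zero_of_not_mem]
      · simp [List.count_cons, hj, cj, hS', List.count_eq_zero_of_not_mem]

theorem TN_list (S R : List ℕ) (a i j : ℕ) (h1 : a ∉ S) (h2 : a ∉ R)
    (h3 : ∀ x ∈ S, x ∉ R) (h4 : ∀ x ∈ S, a < x) (h5 : ∀ x ∈ S, S.count x = 2) :
    TNpair (a :: (S ++ a :: R)) i j ↔
      (i = a ∧ S.getLast? = some j ∧ i < j) ∨ TNpair S i j ∨ TNpair R i j := by
  simp only [TN_iff]
  constructor
  · rintro ⟨hij, u, v, e, cj, ci⟩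
    cases u with
    | nil => simp at ci
    | cons b u =>
      simp only [List.cons_append, List.cons.injEq] at e
      obtain ⟨rfl, e⟩ := e
      have key : a = j → i ∈ u := by
        rintro rfl
        have : 0 < u.count i := by simp [List.count_cons, hij.ne'] at ci; omega
        exact List.count_pos_iff.1 this
      rw [List.append_eq_append_iff] at e
      rcases e with ⟨l, e1, e2⟩ | ⟨l, e1, e2⟩
      · subst e1
        rcases l with _ | ⟨x, l⟩
        · simp only [List.nil_append, List.cons.injEq] at e2
          obtain ⟨rfl, rfl⟩ := e2
          exact absurd (by simp) (h3 i (by simpa using key rfl))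
        · simp only [List.cons_append, List.cons.injEq] at e2
          obtain ⟨rfl, rfl⟩ := e2
          have hS : i ∉ S := fun h => h3 i h (by simp)
          have hS' : j ∉ S := fun h => h3 j h (by simp)
          have hi : a ≠ i := by rintro rfl; simp at h2
          have hj : a ≠ j := by rintro rfl; simp at h2
          right; right
          refine ⟨hij, l, v, rfl, ?_, ?_⟩
          · simpa [List.count_cons, hj, hS', List.count_eq_zero_of_not_mem] using cj
          · simpa [List.count_cons, hi, hS, List.count_eq_zero_of_not_mem] using ci
      · subst e1
        rcases l with _ | ⟨x, _ | ⟨y, l⟩⟩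
        · simp only [List.nil_append, List.cons.injEq] at e2
          obtain ⟨rfl, rfl⟩ := e2
          have := h4 i (by simpa using key rfl)
          omega
        · simp only [List.cons_append, List.nil_append, List.cons.injEq] at e2
          obtain ⟨rfl, rfl, rfl⟩ := e2
          left; simp [hij]
        · simp only [List.cons_append, List.cons.injEq] at e2
          obtain ⟨rfl, rfl, rfl⟩ := e2
          have hi : a ≠ i := by rintro rfl; simp at h1
          have hj : a ≠ j := by rintro rfl; simp at h1
          right; left
          refine ⟨hij, u, l, rfl, ?_, ?_⟩
          · simpa [List.count_cons, hj] using cj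
          · simpa [List.count_cons, hi] using ci
  · rintro (⟨rfl, e, hij⟩ | ⟨hij, u, v, rfl, cj, ci⟩ | ⟨hij, u, v, rfl, cj, ci⟩)
    · obtain ⟨S', rfl⟩ := List.getLast?_eq_some_iff.1 e
      refine ⟨hij, i :: S', R, by simp, ?_, ?_⟩
      · have := h5 j (by simp)
        simpa [List.count_cons, hij.ne] using this
      · simp at h1
        simp [List.count_eq_zero_of_not_mem h1.1]
    · refine ⟨hij, a :: u, v ++ a :: R, by simp, ?_, ?_⟩
      · have hi : a ≠ j := by rintro rfl; simp at h1
        simp [List.count_cons, hi, cj]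
      · have hi : a ≠ i := by rintro rfl; simp at h1
        simp [List.count_cons, hi, ci]
    · have hS : i ∉ S := fun h => h3 i h (by simp)
      have hS' : j ∉ S := fun h => h3 j h (by simp)
      have hi : a ≠ i := by rintro rfl; simp at h2
      have hj : a ≠ j := by rintro rfl; simp at h2
      refine ⟨hij, a :: (S ++ a :: u), v, by simp, ?_, ?_⟩
      · simp [List.count_cons, hj, cj, hS', List.count_eq_zero_of_not_mem]
      · simp [List.count_cons, hi, ci, hS, List.count_eq_zero_of_not_mem]

theorem AA_word (t : STree) (h : inc t) (hn : (labels t).Nodup) (i j : ℕ) :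
    AApair (word t) i j ↔ AAt t i j := by
  induction t with
  | nil => simp [AA_iff, AAt, word]
  | node a s r ih1 ih2 =>
    obtain ⟨h1, h2, h3⟩ := h
    simp only [labels, List.nodup_cons, List.nodup_append, List.mem_append, not_or] at hn
    obtain ⟨⟨n1, n2⟩, n3, n4, n5⟩ := hn
    rw [AAt, ← ih1 h1 n3, ← ih2 h2 n4, ← head_word, word]
    exact AA_list _ _ _ _ _ (by rwa [mem_word]) (by rwa [mem_word])
      (fun x hx hx' => n5 x ((mem_word _ _).1 hx) x ((mem_word _ _).1 hx') rfl)

theorem TN_word (t : STree) (h : inc t) (hn : (labels t).Nodup) (i j : ℕ) :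
    TNpair (word t) i j ↔ TNt t i j := by
  induction t with
  | nil => simp [TN_iff, TNt, word]
  | node a s r ih1 ih2 =>
    obtain ⟨h1, h2, h3⟩ := h
    simp only [labels, List.nodup_cons, List.nodup_append, List.mem_append, not_or] at hn
    obtain ⟨⟨n1, n2⟩, n3, n4, n5⟩ := hn
    rw [TNt, ← ih1 h1 n3, ← ih2 h2 n4, ← last_word, word]
    refine TN_list _ _ _ _ _ (by rwa [mem_word]) (by rwa [mem_word])
      (fun x hx hx' => n5 x ((mem_word _ _).1 hx) x ((mem_word _ _).1 hx') rfl)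
      (fun x hx => h3 x ((mem_word _ _).1 hx)) (fun x hx => ?_)
    rw [count_word s n3, if_pos ((mem_word _ _).1 hx)]

open scoped List

theorem sub_iff (w : List ℕ) (a b : ℕ) : [a, b, a] <+ w ↔
    ∃ i l j : ℕ, i < l ∧ l < j ∧ w[i]? = some a ∧ w[j]? = some a ∧ w[l]? = some b := by
  rw [List.sublist_iff_exists_orderEmbedding_getElem?_eq]
  constructor
  · rintro ⟨f, hf⟩
    refine ⟨f 0, f 1, f 2, by simp, by simp, ?_, ?_, ?_⟩
    · simpa using (hf 0).symm
    · simpa using (hf 2).symm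
    · simpa using (hf 1).symm
  · rintro ⟨i, l, j, h1, h2, e1, e2, e3⟩
    refine ⟨OrderEmbedding.ofStrictMono
      (fun n => if n = 0 then i else if n = 1 then l else if n = 2 then j else w.length + j + n) ?_, ?_⟩
    · intro x y hxy
      simp only
      split_ifs <;> omega
    · intro n
      change _ = w[if n = 0 then i else if n = 1 then l else if n = 2 then j else w.length + j + n]?
      rcases n with _ | _ | _ | n
      · simp [e1]
      · simp [e3]
      · simp [e2]
      · simp [add_assoc]

theorem stirling_iff (A : Finset ℕ) (w : List ℕ) : IsStirling A w ↔
    (∀ a, w.count a = if a ∈ A then 2 else 0) ∧ ∀ a b, [a, b, a] <+ w → a < b := by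
  unfold IsStirling
  refine and_congr_right fun _ => forall_congr' fun a => forall_congr' fun b => ?_
  rw [sub_iff]
  constructor
  · rintro h ⟨i, l, j, h1, h2, e1, e2, e3⟩
    exact h i l j h1 h2 e1 e2 e3
  · intro h i l j h1 h2 e1 e2 e3
    exact h ⟨i, l, j, h1, h2, e1, e2, e3⟩

theorem sub_word (t : STree) (h : inc t) (hn : (labels t).Nodup) (x b : ℕ)
    (hs : [x, b, x] <+ word t) : x < b := by
  induction t with
  | nil => simp [word] at hs
  | node a s r ih1 ih2 =>
    obtain ⟨h1, h2, h3⟩ := h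
    simp only [labels, List.nodup_cons, List.nodup_append, List.mem_append, not_or] at hn
    obtain ⟨⟨n1, n2⟩, n3, n4, n5⟩ := hn
    have m1 : ∀ y, y ∈ word s → a < y := fun y hy => h3 y ((mem_word _ _).1 hy)
    have m2 : a ∉ word r := by rwa [mem_word]
    have m3 : ∀ y, y ∈ word s → y ∉ word r :=
      fun x hx hx' => n5 x ((mem_word _ _).1 hx) x ((mem_word _ _).1 hx') rfl
    rw [word, List.sublist_cons_iff] at hs
    rcases hs with hs | ⟨l, e, hs⟩
    · rw [List.sublist_append_iff] at hs
      obtain ⟨l1, l2, e, s1, s2⟩ := hs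
      rcases l1 with _ | ⟨y, l1⟩
      · simp only [List.nil_append] at e
        subst e
        rw [List.sublist_cons_iff] at s2
        rcases s2 with s2 | ⟨l, e, s2⟩
        · exact ih2 h2 n4 s2
        · simp only [List.cons.injEq] at e
          obtain ⟨rfl, rfl⟩ := e
          exact absurd (s2.subset (by simp)) m2
      · simp only [List.cons_append, List.cons.injEq] at e
        obtain ⟨rfl, e⟩ := e
        have hy : x ∈ word s := s1.subset (by simp)
        have hy1 := m3 x hy
        have hy2 := m1 x hy
        rcases List.eq_nil_or_concat l2 with rfl | ⟨l3, z, rfl⟩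
        · simp only [List.append_nil] at e
          subst e
          exact ih1 h1 n3 s1
        · have hz : x = z := by
            have := congrArg List.getLast? e
            simpa [← List.append_assoc, List.getLast?_append] using this
          subst hz
          have : x ∈ a :: word r := s2.subset (by simp)
          simp only [List.mem_cons] at this
          rcases this with rfl | this
          · omega
          · exact absurd this hy1
    · simp only [List.cons.injEq] at e
      obtain ⟨rfl, rfl⟩ := e
      rw [List.sublist_append_iff] at hs
      obtain ⟨l1, l2, e, s1, s2⟩ := hs
      rcases l1 with _ | ⟨y, l1⟩
      · simp only [List.nil_append] at e
        subst e
        rw [List.sublist_cons_iff] at s2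
        rcases s2 with s2 | ⟨l, e, s2⟩
        · exact absurd (s2.subset (by simp)) m2
        · simp only [List.cons.injEq] at e
          obtain ⟨rfl, rfl⟩ := e
          exact absurd (s2.subset (by simp)) m2
      · simp only [List.cons_append, List.cons.injEq] at e
        obtain ⟨rfl, e⟩ := e
        exact m1 b (s1.subset (by simp))

theorem exists_tree (n : ℕ) (w : List ℕ) (hl : w.length ≤ n) (hc : ∀ a ∈ w, w.count a = 2)
    (hs : ∀ a b, [a, b, a] <+ w → a < b) :
    ∃ t, inc t ∧ (labels t).Nodup ∧ word t = w := by
  induction n generalizing w with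
  | zero =>
    have : w = [] := by simpa using hl
    subst this
    exact ⟨nil, by simp [inc, labels, word]⟩
  | succ n ih =>
    cases w with
    | nil => exact ⟨nil, by simp [inc, labels, word]⟩
    | cons a w =>
      have ha : a ∈ w := by
        have := hc a (by simp)
        simp at this
        exact List.count_pos_iff.1 (by omega)
      obtain ⟨u, v, rfl, hu⟩ := List.eq_append_cons_of_mem ha
      have hv : a ∉ v := by
        have := hc a (by simp)
        simp [List.count_eq_zero_of_not_mem hu] at this
        exact List.count_eq_zero.1 this
      have hgt : ∀ x ∈ u, a < x := by
        intro x hx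
        apply hs
        refine List.Sublist.cons_cons a ?_
        exact (List.singleton_sublist.2 hx).append
          (List.Sublist.cons_cons a (List.nil_sublist v))
      have hd : ∀ x ∈ u, x ∉ v := by
        intro x hx hx'
        have k : x < a := by
          apply hs
          refine List.Sublist.cons a ?_
          exact (List.singleton_sublist.2 hx).append
            (List.Sublist.cons_cons a (List.singleton_sublist.2 hx'))
        have := hgt x hx
        omega
      have su : u <+ a :: (u ++ a :: v) :=
        (List.sublist_append_left u (a :: v)).trans (List.sublist_cons_self _ _)
      have sv : v <+ a :: (u ++ a :: v) :=
        (List.sublist_cons_self a v).trans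
          ((List.sublist_append_right u (a :: v)).trans (List.sublist_cons_self _ _))
      simp at hl
      obtain ⟨s, s1, s2, s3⟩ := ih u (by omega) (by
        intro x hx
        have := hc x (by simp [hx])
        have h1 : a ≠ x := (hgt x hx).ne
        simpa [List.count_cons, h1, List.count_eq_zero_of_not_mem (hd x hx)] using this)
        (fun a b h => hs a b (h.trans su))
      obtain ⟨r, r1, r2, r3⟩ := ih v (by omega) (by
        intro x hx
        have := hc x (by simp [hx])
        have h1 : a ≠ x := by rintro rfl; exact hv hx
        have h2 : x ∉ u := fun h => hd x h hx
        simpa [List.count_cons, h1, List.count_eq_zero_of_not_mem h2] using this)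
        (fun a b h => hs a b (h.trans sv))
      subst s3 r3
      simp only [mem_word] at hu hv hgt hd
      refine ⟨node a s r, ⟨s1, r1, hgt⟩, ?_, rfl⟩
      simp only [labels, List.nodup_cons, List.nodup_append, List.mem_append, not_or]
      refine ⟨⟨hu, hv⟩, s2, r2, ?_⟩
      rintro x hx y hy rfl
      exact hd x hx hy

theorem stirling_tree (A : Finset ℕ) (w : List ℕ) : w ∈ QSetA A ↔
    ∃ t, inc t ∧ (labels t).Nodup ∧ word t = w ∧ ∀ x, x ∈ labels t ↔ x ∈ A := by
  simp only [QSetA, Set.mem_ofPred_eq, stirling_iff]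
  constructor
  · rintro ⟨h1, h2⟩
    have hm : ∀ x, x ∈ w ↔ x ∈ A := by
      intro x
      rw [← List.count_pos_iff, h1 x]
      split_ifs with h <;> simp [h]
    obtain ⟨t, t1, t2, rfl⟩ := exists_tree _ w le_rfl
      (fun a ha => by rw [h1 a, if_pos ((hm a).1 ha)]) h2
    exact ⟨t, t1, t2, rfl, fun x => by rw [← hm, mem_word]⟩
  · rintro ⟨t, t1, t2, rfl, t3⟩
    refine ⟨fun a => ?_, sub_word t t1 t2⟩
    rw [count_word t t2]
    simp only [t3]

theorem QSetA_finite (A : Finset ℕ) : (QSetA A).Finite := by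
  by_cases h : ∃ w₀, w₀ ∈ QSetA A
  · obtain ⟨w₀, h₀⟩ := h
    refine (List.finite_toSet w₀.permutations).subset ?_
    intro w hw
    simp only [Set.mem_ofPred_eq, List.mem_permutations]
    rw [List.perm_iff_count]
    intro a
    rw [hw.1 a, h₀.1 a]
  · have : QSetA A = ∅ := by
      ext w; simp only [Set.mem_empty_iff_false, iff_false]; exact fun hw => h ⟨w, hw⟩
    rw [this]; exact Set.finite_empty

theorem mapsTo (A : Finset ℕ) : Set.MapsTo xiMap (QSetA A) (QSetA A) := by
  intro w hw
  obtain ⟨t, t1, t2, rfl, t3⟩ := (stirling_tree A w).1 hw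
  rw [xiMap_word t t1]
  exact (stirling_tree A _).2 ⟨xi t, inc_xi t t1 t2, (labels_xi t).nodup_iff.2 t2, rfl,
    fun x => by rw [(labels_xi t).mem_iff, t3]⟩

theorem injOn (A : Finset ℕ) : Set.InjOn xiMap (QSetA A) := by
  intro w hw w' hw' he
  obtain ⟨t, t1, t2, rfl, t3⟩ := (stirling_tree A w).1 hw
  obtain ⟨t', t1', t2', rfl, t3'⟩ := (stirling_tree A w').1 hw'
  rw [xiMap_word t t1, xiMap_word t' t1'] at he
  rw [xi_inj t t' t1 t2 t1' t2' (word_inj _ _ (inc_xi t t1 t2) (inc_xi t' t1' t2') he)]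

theorem pairs (A : Finset ℕ) (w : List ℕ) (hw : w ∈ QSetA A) (i j : ℕ) :
    AApair w i j ↔ TNpair (xiMap w) i j := by
  obtain ⟨t, t1, t2, rfl, t3⟩ := (stirling_tree A w).1 hw
  rw [xiMap_word t t1, AA_word t t1 t2, AA_TN t t1 t2,
    TN_word _ (inc_xi t t1 t2) ((labels_xi t).nodup_iff.2 t2)]

end XiProof

/-- The map `ξ : Q_A → Q_A` is a well-defined bijection; it turns ascending
adjacent pairs into terminally nested pairs, and hence carries the ascending
adjacent type `λ^{AA}` to the terminally nested type `λ^{TN}`. -/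
theorem xi_bijection_and_types
    (A : Finset ℕ) (hA : ∀ a ∈ A, 0 < a) :
    Set.BijOn xiMap (QSetA A) (QSetA A) ∧
      (∀ w ∈ QSetA A, ∀ i j : ℕ, AApair w i j ↔ TNpair (xiMap w) i j) ∧
      (∀ w ∈ QSetA A, chainType A (TNpair (xiMap w)) = chainType A (AApair w)) := by
  refine ⟨?_, fun w hw => XiProof.pairs A w hw, ?_⟩
  · exact ((XiProof.QSetA_finite A).injOn_iff_bijOn_of_mapsTo (XiProof.mapsTo A)).1 (XiProof.injOn A)
  · intro w hw
    have : TNpair (xiMap w) = AApair w := by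
      funext i j
      exact propext (XiProof.pairs A w hw i j).symm
    rw [this]
end
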